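/- arXiv:0906.3332 — 3 statements merged into one kernel-verified Lean document; each statement's English description precedes it below -/
import Mathlib

section
/- There exists a single fixed context-free grammar G (a universal context-free grammar) such that for every recursively enumerable language L over the alphabet Σ there exists a monadic transducer A with L_{⊥,f}((G, A)) = L. That is, all recursively enumerable languages over Σ can be obtained from one fixed context-free grammar by varying only the observer. -/
/-!  Common definitions for "computing by observing" G/O systems.

A monadic transducer with input alphabet `V` and output alphabet `Γ` is modelled by its
input/output function `A : List V → Option Γ` (`none` standing for the empty output `λ`),
together with the property `ObserverRegular A` saying that every fiber of `A` is a regular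
language (equivalently, `A` is computed by a complete deterministic finite automaton whose
states are labelled by `Γ ∪ {λ}`).

For a G/O system the output alphabet is `Σ ∪ {⊥}`, modelled as `Option Sig` with
`none` standing for `⊥`; hence observers of G/O systems have type
`List (Symbol T G.NT) → Option (Option Sig)`. -/

/-- Every fiber of the transducer map is a regular language (and the fibers obviously
partition `V*`): this characterizes maps computed by complete deterministic finite
automata with output-labelled states, i.e. monadic transducers. -/
def ObserverRegular {V Γ : Type*} (A : List V → Option Γ) : Prop :=
  ∀ o : Option Γ, Language.IsRegular ({ w : List V | A w = o } : Language V)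

/-- The number of occurrences of nonterminal symbols in a sentential form. -/
def nonterminalCount {T NT : Type*} (w : List (Symbol T NT)) : ℕ :=
  (w.filter fun s => match s with | Symbol.nonterminal _ => true | _ => false).length

/-- The language `L_f(Ω)` (free mode) of the G/O system `Ω = (G, A)`, a language over the
alphabet `Σ ∪ {⊥}` (= `Option Sig`, `none` being `⊥`): all concatenations
`A(w₀)A(w₁)⋯A(wₙ)` of observer outputs along terminating derivations
`S = w₀ ⇒ w₁ ⇒ ⋯ ⇒ wₙ` of `G` with `wₙ` consisting of terminals only. -/
def goLang {T : Type} (G : ContextFreeGrammar T) {Sig : Type}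
    (A : List (Symbol T G.NT) → Option (Option Sig)) : Language (Option Sig) :=
  { x | ∃ ws : List (List (Symbol T G.NT)),
      ws.head? = some [Symbol.nonterminal G.initial] ∧
      List.Chain' G.Produces ws ∧
      (∃ t : List T, ws.getLast? = some (t.map Symbol.terminal)) ∧
      x = (ws.map fun w => (A w).toList).flatten }

/-- The language `L_{⊥,f}(Ω) = L_f(Ω) ∩ Σ*`: the words of `L_f(Ω)` containing no `⊥`,
viewed as a language over `Σ`. -/
def goLangBot {T : Type} (G : ContextFreeGrammar T) {Sig : Type}
    (A : List (Symbol T G.NT) → Option (Option Sig)) : Language Sig :=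
  { x | (x.map some) ∈ goLang G A }

set_option linter.unusedSectionVars false

namespace UGO

open Turing

/-- Actions of a multi-stack machine. -/
inductive Act (K Γ Q : Type)
  | push (k : K) (a : Γ) (q : Q)
  | pop (k : K) (q : Q)
  | jump (q : Q)
  | halt

def Act.map {K Γ Q Q' : Type} (r : Q → Q') : Act K Γ Q → Act K Γ Q'
  | .push k a q => .push k a (r q)
  | .pop k q => .pop k (r q)
  | .jump q => .jump (r q)
  | .halt => .halt

/-- Halting of a multi-stack machine. -/
inductive Halts {K Γ Q : Type} [DecidableEq K] (δ : Q → (K → Option Γ) → Act K Γ Q) :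
    Q → (K → List Γ) → Prop
  | halt (q S) : δ q (fun k => (S k).head?) = .halt → Halts δ q S
  | jump (q S q') : δ q (fun k => (S k).head?) = .jump q' → Halts δ q' S → Halts δ q S
  | push (q S k a q') : δ q (fun k => (S k).head?) = .push k a q' →
      Halts δ q' (Function.update S k (a :: S k)) → Halts δ q S
  | pop (q S k q') : δ q (fun k => (S k).head?) = .pop k q' →
      Halts δ q' (Function.update S k (S k).tail) → Halts δ q S

def Act.Mem {K Γ Q : Type} (F : Set Q) : Act K Γ Q → Prop
  | .push _ _ q => q ∈ F
  | .pop _ q => q ∈ F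
  | .jump q => q ∈ F
  | .halt => True

theorem Act.map_jump {K Γ Q Q' : Type} {r : Q → Q'} {A : Act K Γ Q} {q'}
    (h : A.map r = .jump q') : ∃ q, A = .jump q ∧ r q = q' := by
  cases A <;> simp_all [Act.map]

theorem Act.map_push {K Γ Q Q' : Type} {r : Q → Q'} {A : Act K Γ Q} {k a q'}
    (h : A.map r = .push k a q') : ∃ q, A = .push k a q ∧ r q = q' := by
  cases A <;> simp_all [Act.map]

theorem Act.map_pop {K Γ Q Q' : Type} {r : Q → Q'} {A : Act K Γ Q} {k q'}
    (h : A.map r = .pop k q') : ∃ q, A = .pop k q ∧ r q = q' := by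
  cases A <;> simp_all [Act.map]

/-- Restriction to a closed set of states. -/
theorem halts_restrict {K Γ Q : Type} [DecidableEq K] (δ : Q → (K → Option Γ) → Act K Γ Q)
    (F : Set Q) (hF : ∀ q ∈ F, ∀ τ, (δ q τ).Mem F) (r : Q → F) (hr : ∀ q : F, r q.1 = q)
    (q : F) (S : K → List Γ) :
    Halts (fun (q : F) τ => (δ q.1 τ).map r) q S ↔ Halts δ q.1 S := by
  constructor
  · intro h
    induction h with
    | halt q S h =>
      refine .halt _ _ ?_
      cases h' : δ q.1 (fun k => (S k).head?) <;> simp_all [Act.map]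
    | jump q S q' h _ ih =>
      have := hF q.1 q.2 (fun k => (S k).head?)
      obtain ⟨q2, h', rfl⟩ := Act.map_jump h
      rw [h'] at this
      have e : (r q2).1 = q2 := congrArg Subtype.val (hr ⟨q2, this⟩)
      exact .jump _ _ _ h' (e ▸ ih)
    | push q S k a q' h _ ih =>
      have := hF q.1 q.2 (fun k => (S k).head?)
      obtain ⟨q2, h', rfl⟩ := Act.map_push h
      rw [h'] at this
      have e : (r q2).1 = q2 := congrArg Subtype.val (hr ⟨q2, this⟩)
      exact .push _ _ _ _ _ h' (e ▸ ih)
    | pop q S k q' h _ ih =>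
      have := hF q.1 q.2 (fun k => (S k).head?)
      obtain ⟨q2, h', rfl⟩ := Act.map_pop h
      rw [h'] at this
      have e : (r q2).1 = q2 := congrArg Subtype.val (hr ⟨q2, this⟩)
      exact .pop _ _ _ _ h' (e ▸ ih)
  · obtain ⟨q, hq⟩ := q
    intro h
    simp only at h
    induction h with
    | halt q S h => exact .halt _ _ (by simp [h, Act.map])
    | jump q S q' h _ ih =>
      have := hF q hq (fun k => (S k).head?)
      rw [h] at this
      exact .jump _ _ ⟨q', this⟩ (by simp [h, Act.map, hr ⟨q', this⟩]) (ih this)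
    | push q S k a q' h _ ih =>
      have := hF q hq (fun k => (S k).head?)
      rw [h] at this
      exact .push _ _ k a ⟨q', this⟩ (by simp [h, Act.map, hr ⟨q', this⟩]) (ih this)
    | pop q S k q' h _ ih =>
      have := hF q hq (fun k => (S k).head?)
      rw [h] at this
      exact .pop _ _ k ⟨q', this⟩ (by simp [h, Act.map, hr ⟨q', this⟩]) (ih this)

section TM2

variable {K Γ Λ σ : Type} [DecidableEq K]

/-- small-step control function of a TM2 machine -/
def dTM2 (M : Λ → TM2.Stmt (fun _ : K => Γ) Λ σ) :
    TM2.Stmt (fun _ : K => Γ) Λ σ × σ → (K → Option Γ) →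
      Act K Γ (TM2.Stmt (fun _ : K => Γ) Λ σ × σ)
  | (.push k f q, s), _ => .push k (f s) (q, s)
  | (.peek k f q, s), τ => .jump (q, f s (τ k))
  | (.pop k f q, s), τ => .pop k (q, f s (τ k))
  | (.load f q, s), _ => .jump (q, f s)
  | (.branch p q₁ q₂, s), _ => .jump (cond (p s) q₁ q₂, s)
  | (.goto l, s), _ => .jump (M (l s), s)
  | (.halt, _), _ => .halt

theorem eval_dom_of_halts (M : Λ → TM2.Stmt (fun _ : K => Γ) Λ σ)
    (p : TM2.Stmt (fun _ : K => Γ) Λ σ × σ) (S : K → List Γ) (h : Halts (dTM2 M) p S) :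
    (StateTransition.eval (TM2.step M) (TM2.stepAux p.1 p.2 S)).Dom := by
  induction h with
  | halt p S h =>
    obtain ⟨q, s⟩ := p
    cases q <;> simp_all [dTM2]
    exact Part.dom_iff_mem.2 ⟨_, StateTransition.mem_eval.2 ⟨.refl, rfl⟩⟩
  | jump p S q' h _ ih =>
    obtain ⟨q, s⟩ := p
    cases q <;> simp_all [dTM2]
    · subst h; exact ih
    · subst h; exact ih
    · subst h
      rename_i f a b _
      revert ih
      cases f s <;> simp
    · subst h
      rename_i l _
      rw [StateTransition.reaches_eval (b := TM2.stepAux (M (l s)) s S)]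
      · exact ih
      · exact .single rfl
  | push p S k a q' h _ ih =>
    obtain ⟨q, s⟩ := p
    cases q <;> simp_all [dTM2]
    obtain ⟨rfl, rfl, rfl⟩ := h
    exact ih
  | pop p S k q' h _ ih =>
    obtain ⟨q, s⟩ := p
    cases q <;> simp_all [dTM2]
    obtain ⟨rfl, rfl⟩ := h
    exact ih

theorem halts_stepAux (M : Λ → TM2.Stmt (fun _ : K => Γ) Λ σ)
    (q : TM2.Stmt (fun _ : K => Γ) Λ σ) : ∀ (s : σ) (S : K → List Γ),
    (∀ l, (TM2.stepAux q s S).l = some l →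
      Halts (dTM2 M) (M l, (TM2.stepAux q s S).var) (TM2.stepAux q s S).stk) →
    Halts (dTM2 M) (q, s) S := by
  induction q with
  | push k f q ih => intro s S h; exact .push _ _ _ _ _ rfl (ih _ _ h)
  | peek k f q ih => intro s S h; exact .jump _ _ _ rfl (ih _ _ h)
  | pop k f q ih => intro s S h; exact .pop _ _ _ _ rfl (ih _ _ h)
  | load f q ih => intro s S h; exact .jump _ _ _ rfl (ih _ _ h)
  | branch p q₁ q₂ ih₁ ih₂ =>
    intro s S h
    refine .jump _ _ _ rfl ?_
    simp only [TM2.stepAux] at h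
    cases hp : p s
    · rw [hp] at h; exact ih₂ _ _ h
    · rw [hp] at h; exact ih₁ _ _ h
  | goto l => intro s S h; exact .jump _ _ _ rfl (h _ rfl)
  | halt => intro s S h; exact .halt _ _ rfl

theorem halts_of_eval_dom (M : Λ → TM2.Stmt (fun _ : K => Γ) Λ σ) (c)
    (h : (StateTransition.eval (TM2.step M) c).Dom) :
    ∀ l, c.l = some l → Halts (dTM2 M) (M l, c.var) c.stk := by
  obtain ⟨b, hb⟩ := Part.dom_iff_mem.1 h
  clear h
  refine StateTransition.evalInduction hb ?_
  intro a _ ih l hl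
  obtain ⟨_, s, S⟩ := a
  simp only at hl
  subst hl
  exact halts_stepAux M _ _ _ (ih _ rfl)

theorem halts_iff (M : Λ → TM2.Stmt (fun _ : K => Γ) Λ σ) (l s S) :
    (StateTransition.eval (TM2.step M) ⟨some l, s, S⟩).Dom ↔ Halts (dTM2 M) (M l, s) S := by
  constructor
  · intro h; exact halts_of_eval_dom M _ h l rfl
  · intro h
    have := eval_dom_of_halts M _ _ h
    rwa [StateTransition.reaches_eval (b := TM2.stepAux (M l) s S)]
    exact .single rfl

theorem dTM2_closed (M : Λ → TM2.Stmt (fun _ : K => Γ) Λ σ) (F : Finset Λ)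
    (hF : ∀ q ∈ F, TM2.SupportsStmt F (M q)) :
    ∀ p ∈ {p : TM2.Stmt (fun _ : K => Γ) Λ σ × σ | some p.1 ∈ TM2.stmts M F}, ∀ τ,
      (dTM2 M p τ).Mem {p | some p.1 ∈ TM2.stmts M F} := by
  rintro ⟨q, s⟩ hq τ
  have key : ∀ q', q' ∈ TM2.stmts₁ q → some q' ∈ TM2.stmts M F :=
    fun q' h => TM2.stmts_trans h hq
  have self : ∀ q' : TM2.Stmt (fun _ : K => Γ) Λ σ, q' ∈ TM2.stmts₁ q' :=
    fun _ => TM2.stmts₁_self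
  cases q <;> simp only [dTM2, Act.Mem, Set.mem_ofPred_eq]
  · apply key; simp [TM2.stmts₁, self]
  · apply key; simp [TM2.stmts₁, self]
  · apply key; simp [TM2.stmts₁, self]
  · apply key; simp [TM2.stmts₁, self]
  · rename_i p a b
    apply key
    cases p s <;> simp [TM2.stmts₁, self]
  · rename_i l
    simp only [Set.mem_ofPred_eq, TM2.stmts, Finset.mem_insertNone, Finset.mem_biUnion,
      Option.mem_def, Option.some.injEq, forall_eq'] at hq ⊢
    obtain ⟨l', hl', h⟩ := hq
    have := TM2.stmts₁_supportsStmt_mono h (hF l' hl')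
    exact ⟨l s, this s, self _⟩

end TM2

/-- Content of each stack in a word of labelled letters. -/
def stksOf {K Γ : Type} [DecidableEq K] (v : List (K × Γ)) (k : K) : List Γ :=
  v.filterMap fun p => if p.1 = k then some p.2 else none

section Univ
open PartrecToTM2

variable {Sig : Type} [Fintype Sig] [Primcodable Sig]

noncomputable def idx (a : Sig) : ℕ := (Fintype.equivFin Sig a : ℕ)

theorem idx_inj : Function.Injective (idx : Sig → ℕ) := fun _ _ h =>
  (Fintype.equivFin Sig).injective (Fin.ext h)

noncomputable def phi (x : List Sig) : ℕ :=
  x.foldl (fun n a => 2 ^ idx a * (2 * n + 1)) 0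

theorem pow_odd_inj : ∀ i j n m : ℕ, 2 ^ i * (2 * n + 1) = 2 ^ j * (2 * m + 1) → i = j ∧ n = m
  | 0, 0, n, m, h => by simp at h; omega
  | 0, j + 1, n, m, h => by exfalso; rw [pow_succ, mul_assoc, mul_left_comm] at h; omega
  | i + 1, 0, n, m, h => by exfalso; rw [pow_succ, mul_assoc, mul_left_comm] at h; omega
  | i + 1, j + 1, n, m, h => by
    rw [pow_succ, pow_succ, mul_assoc, mul_left_comm, mul_assoc, mul_left_comm (2 ^ j)] at h
    have := pow_odd_inj i j n m (by omega)
    omega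

theorem phi_inj : Function.Injective (phi : List Sig → ℕ) := by
  intro x
  induction x using List.reverseRecOn with
  | nil =>
    intro y h
    cases y using List.reverseRecOn with
    | nil => rfl
    | append_singleton y b => simp [phi] at h
  | append_singleton x a ih =>
    intro y h
    cases y using List.reverseRecOn with
    | nil => simp [phi] at h
    | append_singleton y b =>
      simp only [phi, List.foldl_append, List.foldl_cons, List.foldl_nil] at h
      obtain ⟨h1, h2⟩ := pow_odd_inj _ _ _ _ h
      rw [idx_inj h1, ih h2]

theorem phi_computable : Primrec (phi : List Sig → ℕ) := by
  refine Primrec.list_foldl (h := fun _ p => 2 ^ idx p.2 * (2 * p.1 + 1)) Primrec.id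
    (Primrec.const 0) ?_
  refine Primrec.nat_mul.comp ?_ ?_
  · exact (Primrec.dom_finite fun a : Sig => 2 ^ idx a).comp (Primrec.snd.comp Primrec.snd)
  · exact Primrec.succ.comp (Primrec.nat_mul.comp (Primrec.const 2)
      (Primrec.fst.comp Primrec.snd))

theorem exists_index (L : Language Sig) (hL : REPred fun x => x ∈ L) :
    ∃ c : Nat.Partrec.Code, ∀ x : List Sig, x ∈ L ↔ (c.eval (phi x)).Dom := by
  classical
  have h1 : Partrec fun m : ℕ => Nat.rfindOpt fun n =>
      (Encodable.decode (α := List Sig) n).bind fun x => if phi x = m then some x else none := by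
    refine Partrec.rfindOpt ?_
    refine Computable.option_bind (Computable.decode.comp Computable.snd) ?_
    refine Primrec.to_comp ?_
    refine Primrec.ite (Primrec.eq.comp (phi_computable.comp Primrec.snd)
      (Primrec.fst.comp Primrec.fst)) (Primrec.option_some.comp Primrec.snd) (Primrec.const none)
  have h2 : Partrec fun m : ℕ => (Nat.rfindOpt fun n =>
      (Encodable.decode (α := List Sig) n).bind fun x => if phi x = m then some x else none).bind
      fun x => (Part.assert (x ∈ L) fun _ => Part.some ()).map fun _ => (0 : ℕ) := by
    refine h1.bind ?_
    exact (Partrec.map hL (Computable.const 0).to₂).comp Computable.snd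
  obtain ⟨c, hc⟩ := Nat.Partrec.Code.exists_code.1 (Partrec.nat_iff.1 h2)
  refine ⟨c, fun x => ?_⟩
  rw [hc]
  have h3 : x ∈ Nat.rfindOpt fun n =>
      (Encodable.decode (α := List Sig) n).bind fun x' =>
        if phi x' = phi x then some x' else none := by
    have hd : (Nat.rfindOpt fun n =>
      (Encodable.decode (α := List Sig) n).bind fun x' =>
        if phi x' = phi x then some x' else none).Dom :=
      Nat.rfindOpt_dom.2 ⟨Encodable.encode x, x, by simp⟩
    obtain ⟨y, hy⟩ := Part.dom_iff_mem.1 hd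
    obtain ⟨n, hn⟩ := Nat.rfindOpt_spec hy
    have : phi y = phi x := by
      simp only [Option.mem_def, Option.bind_eq_some_iff, Option.ite_none_right_eq_some,
        Option.some.injEq] at hn
      obtain ⟨z, _, h, rfl⟩ := hn
      exact h
    rw [phi_inj this] at hy
    exact hy
  beta_reduce
  rw [Part.eq_some_iff.2 h3]
  simp [Part.assert]

theorem trNat_step (i n : ℕ) :
    trNat (2 ^ i * (2 * n + 1)) = List.replicate i Γ'.bit0 ++ Γ'.bit1 :: trNat n := by
  induction i with
  | zero =>
    rw [pow_zero, one_mul]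
    have : (((2 * n + 1 : ℕ)) : Num) = Num.bit1 (n : Num) := by
      apply Num.to_nat_inj.1
      simp [two_mul]
    rw [trNat, this, trNat]
    cases (n : Num) <;> rfl
  | succ i ih =>
    have : (((2 ^ (i + 1) * (2 * n + 1) : ℕ)) : Num) =
        Num.bit0 ((2 ^ i * (2 * n + 1) : ℕ) : Num) := by
      apply Num.to_nat_inj.1
      rw [Num.to_of_nat, Num.cast_bit0, Num.to_of_nat]
      ring
    rw [trNat, this]
    rw [trNat] at ih
    have ne : (((2 ^ i * (2 * n + 1) : ℕ)) : Num) ≠ Num.zero := by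
      intro h
      have := congrArg (fun k : Num => (k : ℕ)) h
      simp only [Num.to_of_nat] at this
      have h0 : ((Num.zero : Num) : ℕ) = 0 := rfl
      rw [h0] at this
      simp at this
    cases h : (((2 ^ i * (2 * n + 1) : ℕ)) : Num) with
    | zero => exact absurd h ne
    | pos p =>
      rw [h] at ih
      change Γ'.bit0 :: trPosNum p = _
      change trPosNum p = _ at ih
      rw [ih]; rfl

noncomputable def enc (a : Sig) : List (K' × Γ') :=
  (List.replicate (idx a) Γ'.bit0 ++ [Γ'.bit1]).map fun g => (K'.main, g)

instance : Finite K' :=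
  Finite.of_surjective (fun i : Fin 4 => match i with
    | 0 => K'.main | 1 => K'.rev | 2 => K'.aux | 3 => K'.stack) (by
      intro k
      cases k
      · exact ⟨0, rfl⟩
      · exact ⟨1, rfl⟩
      · exact ⟨2, rfl⟩
      · exact ⟨3, rfl⟩)

theorem foldl_enc (x : List Sig) (p : List Γ') :
    x.foldl (fun v a => enc a ++ v) (p.map fun g => (K'.main, g)) =
      (trNat (phi x) ++ p).map fun g => (K'.main, g) := by
  induction x using List.reverseRecOn with
  | nil => simp [phi]
  | append_singleton x a ih =>
    rw [List.foldl_append, ih]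
    simp only [List.foldl_cons, List.foldl_nil, enc, phi, List.foldl_append, trNat_step]
    simp

theorem stksOf_main (p : List Γ') :
    stksOf (p.map fun g => (K'.main, g)) = K'.elim p [] [] [] := by
  funext k
  cases k <;> simp [stksOf, K'.elim, List.filterMap_map, Function.comp_def]

theorem exists_machine (Sig : Type) [Fintype Sig] [Primcodable Sig] :
    ∃ (Q : Type) (_ : Finite Q) (q0 : Q) (δ : Q → (K' → Option Γ') → Act K' Γ' Q)
      (enc : Sig → List (K' × Γ')),
      ∀ L : Language Sig, (REPred fun x => x ∈ L) → ∃ p : List (K' × Γ'),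
        ∀ x : List Sig, x ∈ L ↔ Halts δ q0 (stksOf (x.foldl (fun v a => enc a ++ v) p)) := by
  classical
  let f : ℕ → ℕ →. ℕ := fun m e => (Denumerable.ofNat Nat.Partrec.Code e).eval m
  have hf : Partrec₂ f :=
    Nat.Partrec.Code.eval_part.comp ((Computable.ofNat _).comp Computable.snd) Computable.fst
  obtain ⟨c, hc⟩ := ToPartrec.Code.exists_code (Nat.Partrec'.part_iff₂.2 hf)
  let F := codeSupp c Cont'.halt
  have hF := (tr_supports c Cont'.halt)
  let FS : Set (TM2.Stmt (fun _ : K' => Γ') Λ' (Option Γ') × Option Γ') :=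
    {p | some p.1 ∈ TM2.stmts tr F}
  have hfin : FS.Finite := by
    have : FS ⊆ (TM2.stmts tr F).eraseNone ×ˢ (Set.univ : Set (Option Γ')) := by
      intro p hp
      simpa [FS] using hp
    exact ((Finset.finite_toSet _).prod Set.finite_univ).subset this
  let i0 : TM2.Stmt (fun _ : K' => Γ') Λ' (Option Γ') × Option Γ' :=
    (tr (trNormal c Cont'.halt), none)
  have hi0 : i0 ∈ FS := by
    simp only [FS, i0, Set.mem_ofPred_eq, TM2.stmts, Finset.mem_insertNone, Finset.mem_biUnion,
      Option.mem_def, Option.some.injEq, forall_eq']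
    exact ⟨_, hF.1, TM2.stmts₁_self⟩
  let r : TM2.Stmt (fun _ : K' => Γ') Λ' (Option Γ') × Option Γ' → FS :=
    fun q => if h : q ∈ FS then ⟨q, h⟩ else ⟨i0, hi0⟩
  have hr : ∀ q : FS, r q.1 = q := fun q => by simp [r]
  refine ⟨FS, hfin, ⟨i0, hi0⟩, fun q τ => (dTM2 tr q.1 τ).map r, enc, fun L hL => ?_⟩
  obtain ⟨d, hd⟩ := exists_index L hL
  refine ⟨(Γ'.cons :: trNat (Encodable.encode d) ++ [Γ'.cons]).map fun g => (K'.main, g),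
    fun x => ?_⟩
  rw [halts_restrict (dTM2 tr) FS (dTM2_closed tr F hF.2) r hr, foldl_enc, stksOf_main]
  have h1 := tr_eval c [phi x, Encodable.encode d]
  have h2 := hc (⟨[phi x, Encodable.encode d], rfl⟩)
  rw [h2] at h1
  have h3 := halts_iff tr (trNormal c Cont'.halt) none
    (K'.elim (trList [phi x, Encodable.encode d]) [] [] [])
  have h4 : trNat (phi x) ++ (Γ'.cons :: trNat (Encodable.encode d) ++ [Γ'.cons]) =
    trList [phi x, Encodable.encode d] := by simp
  rw [h4, ← h3, hd x]
  change _ ↔ (StateTransition.eval (TM2.step tr) (init c [phi x, Encodable.encode d])).Dom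
  rw [h1]
  have : f (phi x) (Encodable.encode d) = d.eval (phi x) := by simp [f]
  rw [← this]
  rfl

end Univ

section Recog

/-- `f` is computed by a finite deterministic automaton with labelled states. -/
def Rec {V α : Type} (f : List V → α) : Prop :=
  ∃ (σ : Type) (_ : Finite σ) (st : σ → V → σ) (i : σ) (o : σ → α), ∀ w, f w = o (w.foldl st i)

variable {V α β : Type}

theorem Rec.comp {f : List V → α} (hf : Rec f) (g : α → β) : Rec fun w => g (f w) := by
  obtain ⟨σ, hσ, st, i, o, h⟩ := hf
  exact ⟨σ, hσ, st, i, fun s => g (o s), fun w => by simp only [h]⟩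

theorem Rec.pair {f : List V → α} {g : List V → β} (hf : Rec f) (hg : Rec g) :
    Rec fun w => (f w, g w) := by
  obtain ⟨σ, hσ, st, i, o, h⟩ := hf
  obtain ⟨σ', hσ', st', i', o', h'⟩ := hg
  refine ⟨σ × σ', inferInstance, fun s a => (st s.1 a, st' s.2 a), (i, i'),
    fun s => (o s.1, o' s.2), fun w => ?_⟩
  have : ∀ (w : List V) i i', w.foldl (fun (s : σ × σ') a => (st s.1 a, st' s.2 a)) (i, i') =
      (w.foldl st i, w.foldl st' i') := by
    intro w
    induction w with
    | nil => intros; rfl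
    | cons a w ih => intro i i'; simp [ih]
  simp only [this, h, h']

theorem Rec.map₂ {γ : Type} {f : List V → α} {g : List V → β} (hf : Rec f) (hg : Rec g)
    (F : α → β → γ) : Rec fun w => F (f w) (g w) :=
  (hf.pair hg).comp fun p => F p.1 p.2

theorem rec_const (c : α) : Rec fun _ : List V => c :=
  ⟨Unit, inferInstance, fun _ _ => (), (), fun _ => c, fun _ => rfl⟩

theorem Rec.regular {γ : Type} {A : List V → Option γ} (hA : Rec A) : ObserverRegular A := by
  intro o
  obtain ⟨σ, hσ, st, i, out, h⟩ := hA
  have := Fintype.ofFinite σ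
  refine ⟨σ, this, ⟨st, i, {s | out s = o}⟩, ?_⟩
  ext w
  rw [DFA.mem_accepts]
  change out (w.foldl st i) = o ↔ A w = o
  rw [h]

theorem rec_head {γ : Type} [Finite γ] (g : V → Option γ) :
    Rec fun w : List V => (w.filterMap g).head? := by
  refine ⟨Option γ, inferInstance, fun s a => s.or (g a), none, id, fun w => ?_⟩
  have : ∀ (w : List V) s, w.foldl (fun (s : Option γ) a => s.or (g a)) s =
      s.or (w.filterMap g).head? := by
    intro w
    induction w with
    | nil => simp
    | cons a w ih =>
      intro s
      rw [List.foldl_cons, ih]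
      cases s <;> cases h : g a <;> simp [h]
  rw [this]
  simp

theorem rec_exists (p : V → Prop) : Rec fun w : List V => ∃ s ∈ w, p s := by
  classical
  refine ⟨Prop, inferInstance, fun s a => s ∨ p a, False, id, fun w => ?_⟩
  have : ∀ (w : List V) (s : Prop), w.foldl (fun (s : Prop) a => s ∨ p a) s =
      (s ∨ ∃ a ∈ w, p a) := by
    intro w
    induction w with
    | nil => simp
    | cons a w ih =>
      intro s
      rw [List.foldl_cons, ih]
      simp [or_assoc]
  rw [this]
  simp

theorem rec_parity (p : V → Bool) : Rec fun w : List V => (w.countP p).bodd := by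
  refine ⟨Bool, inferInstance, fun s a => s ^^ (p a), false, id, fun w => ?_⟩
  have : ∀ (w : List V) (s : Bool), w.foldl (fun (s : Bool) a => s ^^ (p a)) s =
      (s ^^ (w.countP p).bodd) := by
    intro w
    induction w with
    | nil => simp
    | cons a w ih =>
      intro s
      rw [List.foldl_cons, ih, List.countP_cons]
      cases s <;> cases h : p a <;> simp
  rw [this]
  simp

theorem rec_eq (w0 : List V) : Rec fun w : List V => w = w0 := by
  have hreg : Language.IsRegular ({w | w = w0} : Language V) := by
    apply Language.IsRegular.of_finite_range_leftQuotient
    refine Set.Finite.subset (s := insert ∅ ((fun y : List V => ({y} : Set (List V))) ''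
      {y | y ∈ w0.tails})) ?_ ?_
    · exact ((List.finite_toSet _).image _).insert _
    · rintro _ ⟨x, rfl⟩
      by_cases hx : ∃ y, x ++ y = w0
      · obtain ⟨y, rfl⟩ := hx
        refine Or.inr ⟨y, ?_, ?_⟩
        · simp
        · ext z
          change z = y ↔ x ++ z = x ++ y
          simp
      · refine Or.inl ?_
        ext z
        change x ++ z = w0 ↔ False
        simp only [iff_false]
        exact fun h => hx ⟨z, h⟩
  obtain ⟨σ, hσ, D, hD⟩ := hreg
  refine ⟨σ, inferInstance, D.step, D.start, fun s => s ∈ D.accept, fun w => ?_⟩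
  have : w ∈ D.accepts ↔ w = w0 := by rw [hD]; rfl
  rw [DFA.mem_accepts] at this
  exact propext this.symm

end Recog

section Generic

variable {B R Sig : Type}

/-- Symbols of the grammar: base symbols and rule marks. -/
abbrev Sy (B R : Type) := Symbol Bool (B ⊕ R)

abbrev bs (b : B) : Sy B R := Symbol.nonterminal (Sum.inl b)
abbrev mk (r : R) : Sy B R := Symbol.nonterminal (Sum.inr r)
abbrev tm (t : Bool) : Sy B R := Symbol.terminal t

def isT : Sy B R → Prop
  | .terminal _ => True
  | .nonterminal _ => False

def ruleSet (lhs : R → B) (rhs : R → List B) (H : B) : Set (ContextFreeRule Bool (B ⊕ R)) :=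
  (Set.range fun r => ⟨Sum.inl (lhs r), [mk r]⟩) ∪
  ((Set.range fun r => ⟨Sum.inr r, (rhs r).map bs⟩) ∪
  ((Set.range fun n => ⟨n, [tm false]⟩) ∪ {⟨Sum.inl H, [tm true]⟩}))

theorem ruleSet_finite [Finite B] [Finite R] (lhs : R → B) (rhs : R → List B) (H : B) :
    (ruleSet lhs rhs H).Finite :=
  (Set.finite_range _).union ((Set.finite_range _).union ((Set.finite_range _).union
    (Set.finite_singleton _)))

noncomputable def gram [Finite B] [Finite R] (lhs : R → B) (rhs : R → List B) (S H : B) :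
    ContextFreeGrammar Bool where
  NT := B ⊕ R
  initial := Sum.inl S
  rules := (ruleSet_finite lhs rhs H).toFinset

def Pr (lhs : R → B) (rhs : R → List B) (H : B) (w w' : List (Sy B R)) : Prop :=
  ∃ u v, (∃ r, w = u ++ bs (lhs r) :: v ∧ w' = u ++ mk r :: v) ∨
    (∃ r, w = u ++ mk r :: v ∧ w' = u ++ (rhs r).map bs ++ v) ∨
    (∃ n, w = u ++ Symbol.nonterminal n :: v ∧ w' = u ++ tm false :: v) ∨
    (w = u ++ bs H :: v ∧ w' = u ++ tm true :: v)

theorem pr_of_rewrites (lhs : R → B) (rhs : R → List B) (H : B)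
    (w w' : List (Sy B R)) (r : ContextFreeRule Bool (B ⊕ R)) (hr : r ∈ ruleSet lhs rhs H)
    (hw : r.Rewrites w w') : Pr lhs rhs H w w' := by
  obtain ⟨u, v, h1, h2⟩ := hw.exists_parts
  subst h1 h2
  refine ⟨u, v, ?_⟩
  rcases hr with ⟨r, rfl⟩ | ⟨r, rfl⟩ | ⟨n, rfl⟩ | rfl
  · exact Or.inl ⟨r, by simp, by simp⟩
  · exact Or.inr (Or.inl ⟨r, by simp, by simp⟩)
  · exact Or.inr (Or.inr (Or.inl ⟨n, by simp, by simp⟩))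
  · exact Or.inr (Or.inr (Or.inr ⟨by simp, by simp⟩))

theorem produces_iff [Finite B] [Finite R] (lhs : R → B) (rhs : R → List B) (S H : B)
    (w w' : List (Sy B R)) :
    (gram lhs rhs S H).Produces w w' ↔ Pr lhs rhs H w w' := by
  constructor
  · rintro ⟨r, hr, hw⟩
    exact pr_of_rewrites lhs rhs H w w' r ((Set.Finite.mem_toFinset _).1 hr) hw
  · have key : ∀ r ∈ ruleSet lhs rhs H, ∀ u v w w' : List (Sy B R),
        w = u ++ [Symbol.nonterminal r.input] ++ v → w' = u ++ r.output ++ v →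
        (gram lhs rhs S H).Produces w w' := by
      rintro r hr u v _ _ rfl rfl
      exact ⟨r, (Set.Finite.mem_toFinset _).2 hr, ContextFreeRule.rewrites_of_exists_parts r u v⟩
    rintro ⟨u, v, ⟨r, rfl, rfl⟩ | ⟨r, rfl, rfl⟩ | ⟨n, rfl, rfl⟩ | ⟨rfl, rfl⟩⟩
    · exact key ⟨Sum.inl (lhs r), [mk r]⟩ (Or.inl ⟨r, rfl⟩) u v _ _ (by simp) (by simp)
    · exact key ⟨Sum.inr r, (rhs r).map bs⟩ (Or.inr (Or.inl ⟨r, rfl⟩)) u v _ _ (by simp) (by simp)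
    · exact key ⟨n, [tm false]⟩ (Or.inr (Or.inr (Or.inl ⟨n, rfl⟩))) u v _ _ (by simp) (by simp)
    · exact key ⟨Sum.inl H, [tm true]⟩ (Or.inr (Or.inr (Or.inr rfl))) u v _ _ (by simp) (by simp)

/-- Observed derivations. -/
inductive Obs (pr : List (Sy B R) → List (Sy B R) → Prop)
    (A : List (Sy B R) → Option (Option Sig)) (w0 : List (Sy B R)) :
    List (Sy B R) → List (Option Sig) → Prop
  | start : Obs pr A w0 w0 (A w0).toList
  | step (w x w') : Obs pr A w0 w x → pr w w' → Obs pr A w0 w' (x ++ (A w').toList)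

theorem obs_iff (pr : List (Sy B R) → List (Sy B R) → Prop)
    (A : List (Sy B R) → Option (Option Sig)) (w0 w : List (Sy B R)) (x : List (Option Sig)) :
    Obs pr A w0 w x ↔ ∃ ws : List (List (Sy B R)), ws.head? = some w0 ∧ List.IsChain pr ws ∧
      ws.getLast? = some w ∧ x = (ws.map fun w => (A w).toList).flatten := by
  constructor
  · intro h
    induction h with
    | start => exact ⟨[w0], by simp⟩
    | step w x w' _ hp ih =>
      obtain ⟨ws, h1, h2, h3, rfl⟩ := ih
      refine ⟨ws ++ [w'], ?_, ?_, ?_, ?_⟩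
      · cases ws <;> simp_all
      · rw [List.isChain_append]
        refine ⟨h2, by simp, ?_⟩
        intro a ha b hb
        rw [h3] at ha
        simp at ha hb
        subst ha hb
        exact hp
      · simp
      · simp
  · rintro ⟨ws, h1, h2, h3, rfl⟩
    induction ws using List.reverseRecOn generalizing w with
    | nil => simp at h1
    | append_singleton ws w' ih =>
      simp at h3
      subst h3
      rcases List.eq_nil_or_concat ws with rfl | ⟨ws', w2, rfl⟩
      · simp at h1
        subst h1
        simpa using Obs.start (pr := pr) (A := A) (w0 := w')
      · rw [List.isChain_append] at h2
        have := Obs.step _ _ w' (ih w2 (by cases ws' <;> simp_all) h2.1 (by simp))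
          (h2.2.2 w2 (by simp) w' (by simp))
        simpa using this

theorem goLang_eq [Finite B] [Finite R] (lhs : R → B) (rhs : R → List B) (S H : B)
    (A : List (Sy B R) → Option (Option Sig)) (x : List (Option Sig)) :
    x ∈ goLang (gram lhs rhs S H) A ↔
      ∃ t : List Bool, Obs (Pr lhs rhs H) A [bs S] (t.map Symbol.terminal) x := by
  have e : (gram lhs rhs S H).Produces = Pr lhs rhs H := by
    funext w w'
    exact propext (produces_iff lhs rhs S H w w')
  simp only [obs_iff]
  constructor
  · rintro ⟨ws, h1, h2, ⟨t, h3⟩, h4⟩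
    have h2 : List.IsChain (gram lhs rhs S H).Produces ws := h2
    rw [e] at h2
    exact ⟨t, ws, h1, h2, h3, h4⟩
  · rintro ⟨t, ws, h1, h2, h3, h4⟩
    rw [← e] at h2
    exact ⟨ws, h1, h2, ⟨t, h3⟩, h4⟩

/-- Conditional rewriting. -/
inductive Der (lhs : R → B) (rhs : R → List B) (S H : B) (P : List (Sy B R) → Prop)
    (out : R → Option Sig) : List Sig → List B → Prop
  | init : Der lhs rhs S H P out [] [S]
  | step (x u r v) : Der lhs rhs S H P out x (u ++ lhs r :: v) → H ∉ u ++ lhs r :: v →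
      P (u.map bs ++ mk r :: v.map bs) →
      Der lhs rhs S H P out (x ++ (out r).toList) (u ++ rhs r ++ v)

def mstep (acc : Option (Option R)) (s : Sy B R) : Option (Option R) :=
  match s with
  | .nonterminal (.inr r) => match acc with
    | none => some (some r)
    | some _ => some none
  | _ => acc

def minfo (w : List (Sy B R)) : Option (Option R) := w.foldl mstep none

theorem foldl_mstep_base (u : List B) (acc : Option (Option R)) :
    (u.map bs).foldl mstep acc = acc := by
  induction u with
  | nil => rfl
  | cons a u ih => simpa [mstep] using ih

theorem minfo_base (u : List B) : minfo (u.map bs : List (Sy B R)) = none :=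
  foldl_mstep_base u none

theorem minfo_mark (u v : List B) (r : R) :
    minfo (u.map bs ++ mk r :: v.map bs) = some (some r) := by
  simp [minfo, foldl_mstep_base, mstep]

theorem foldl_mstep_many (w : List (Sy B R)) :
    w.foldl mstep (some none) = some none := by
  induction w with
  | nil => rfl
  | cons a w ih =>
    rcases a with a | a | a <;> simpa [mstep] using ih

theorem foldl_mstep_some (w : List (Sy B R)) (o : Option R) :
    ∃ o', w.foldl mstep (some o) = some o' := by
  induction w generalizing o with
  | nil => exact ⟨o, rfl⟩
  | cons a w ih =>
    rcases a with a | a | a <;> simpa [mstep] using ih _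

theorem minfo_two (w1 w2 w3 : List (Sy B R)) (r r' : R) :
    minfo (w1 ++ mk r :: (w2 ++ mk r' :: w3)) = some none := by
  simp only [minfo, List.foldl_append, List.foldl_cons]
  have : ∃ o, mstep (List.foldl mstep none w1) (mk r : Sy B R) = some o := by
    cases List.foldl mstep none w1 <;> exact ⟨_, rfl⟩
  obtain ⟨o, ho⟩ := this
  rw [ho]
  obtain ⟨o', ho'⟩ := foldl_mstep_some w2 o
  rw [ho']
  exact foldl_mstep_many w3

open Classical in
noncomputable def obsv (H : B) (P : List (Sy B R) → Prop) (out : R → Option Sig)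
    (w : List (Sy B R)) : Option (Option Sig) :=
  if ∃ s ∈ w, s = bs H then none
  else if ¬ ∃ s ∈ w, ¬ isT s then (if ∃ s ∈ w, s = tm true then none else some none)
  else if ∃ s ∈ w, isT s then some none
  else match minfo w with
    | none => none
    | some none => some none
    | some (some r) => if P w then (out r).map some else some none

theorem rec_minfo [Finite R] : Rec (minfo : List (Sy B R) → _) :=
  ⟨Option (Option R), inferInstance, mstep, none, id, fun _ => rfl⟩

theorem rec_obsv [Finite R] (H : B) (P : List (Sy B R) → Prop) (hP : Rec P)
    (out : R → Option Sig) : Rec (obsv H P out) := by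
  classical
  have := ((rec_exists (fun s : Sy B R => s = bs H)).pair
    (((rec_exists (fun s : Sy B R => ¬ isT s)).pair
      (rec_exists (fun s : Sy B R => s = tm true))).pair
    ((rec_exists (fun s : Sy B R => isT s)).pair (rec_minfo.pair hP)))).comp
    (fun p => if p.1 then none else if ¬ p.2.1.1 then (if p.2.1.2 then none else some none)
      else if p.2.2.1 then some none else match p.2.2.2.1 with
        | none => none
        | some none => some none
        | some (some r) => if p.2.2.2.2 then (out r).map some else some none)
  convert this using 2 with w
  unfold obsv
  dsimp only
  congr!

variable (H : B) (P : List (Sy B R) → Prop) (out : R → Option Sig)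

theorem obsv_H {w : List (Sy B R)} (h : bs H ∈ w) : obsv H P out w = none := by
  simp [obsv, h]

theorem obsv_bad {w : List (Sy B R)} (h : bs H ∉ w) (h1 : ∃ s ∈ w, isT s)
    (h2 : tm true ∉ w ∨ ∃ s ∈ w, ¬ isT s) : obsv H P out w = some none := by
  unfold obsv
  rw [if_neg (by simpa using h)]
  by_cases h3 : ∃ s ∈ w, ¬ isT s
  · rw [if_neg (not_not.2 h3), if_pos h1]
  · rw [if_pos h3, if_neg]
    have := h2.resolve_right h3
    simpa using this

theorem obsv_allT {w : List (Sy B R)} (h : bs H ∉ w) (h1 : ∀ s ∈ w, isT s) :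
    obsv H P out w = none ∨ obsv H P out w = some none := by
  unfold obsv
  rw [if_neg (by simpa using h), if_pos (by simpa using h1)]
  split_ifs <;> simp

theorem obsv_nil : obsv H P out [] = some none := by
  simp [obsv]

theorem obsv_two {w : List (Sy B R)} (h : bs H ∉ w) (h1 : minfo w = some none) (r : R)
    (h2 : mk r ∈ w) : obsv H P out w = some none := by
  unfold obsv
  rw [if_neg (by simpa using h), if_neg (not_not.2 ⟨_, h2, by simp [isT]⟩)]
  by_cases h3 : ∃ s ∈ w, isT s
  · rw [if_pos h3]
  · rw [if_neg h3, h1]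

theorem obsv_base {z : List B} (h : H ∉ z) (h0 : z ≠ []) :
    obsv H P out (z.map bs) = none := by
  unfold obsv
  obtain ⟨a, z, rfl⟩ := List.exists_cons_of_ne_nil h0
  rw [if_neg (by simpa using h), if_neg (not_not.2 ⟨bs a, by simp, by simp [isT]⟩),
    if_neg (by simp [isT]), minfo_base]

open Classical in
theorem obsv_mark {u v : List B} {r : R} (h : H ∉ u ++ v) :
    obsv H P out (u.map bs ++ mk r :: v.map bs) =
      if P (u.map bs ++ mk r :: v.map bs) then (out r).map some else some none := by
  unfold obsv
  rw [if_neg (by simpa using h), if_neg (not_not.2 ⟨mk r, by simp, by simp [isT]⟩),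
    if_neg (by simp [isT, or_imp, forall_and]), minfo_mark]

variable (lhs : R → B) (rhs : R → List B) (S : B)

theorem map_split {u v : List (Sy B R)} {z : List B} {s : Sy B R}
    (h : z.map bs = u ++ s :: v) :
    ∃ (u' : List B) (b : B) (v' : List B), z = u' ++ b :: v' ∧ u = u'.map bs ∧ s = bs b ∧ v = v'.map bs := by
  rw [List.map_eq_append_iff] at h
  obtain ⟨u', t, rfl, rfl, h⟩ := h
  rw [List.map_eq_cons_iff] at h
  obtain ⟨b, v', rfl, rfl, rfl⟩ := h
  exact ⟨u', b, v', rfl, rfl, rfl, rfl⟩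

theorem bs_mem {b : B} {z : List B} : (bs b : Sy B R) ∈ z.map bs ↔ b ∈ z := by
  simp

def Inv (y : List Sig) (w : List (Sy B R)) : Prop :=
  (∃ z, w = z.map bs ∧ H ∉ z ∧ z ≠ [] ∧ Der lhs rhs S H P out y z) ∨
  (∃ u r v y', w = u.map bs ++ mk r :: v.map bs ∧ H ∉ u ++ lhs r :: v ∧
    P (u.map bs ++ mk r :: v.map bs) ∧ Der lhs rhs S H P out y' (u ++ lhs r :: v) ∧
    y = y' ++ (out r).toList) ∨
  ((∃ z, H ∈ z ∧ Der lhs rhs S H P out y z) ∧ (bs H ∈ w ∨ ∀ s ∈ w, isT s))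

theorem inv_of_obs (hS : S ≠ H) (hl : ∀ r, lhs r ≠ H) {w : List (Sy B R)} {x : List (Option Sig)}
    (h : Obs (Pr lhs rhs H) (obsv H P out) [bs S] w x) :
    ∀ y : List Sig, x = y.map some → Inv H P out lhs rhs S y w := by
  induction h with
  | start =>
    intro y hy
    have := obsv_base H P out (z := [S]) (by simpa using hS.symm) (by simp)
    simp only [List.map_cons, List.map_nil] at this
    rw [this] at hy
    have : y = [] := by simpa using hy.symm
    subst this
    exact Or.inl ⟨[S], rfl, by simpa using hS.symm, by simp, Der.init⟩
  | step w x w' _ hp ih =>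
    intro y hy
    have hbad : obsv H P out w' ≠ some none := by
      intro hb
      rw [hb] at hy
      have : (none : Option Sig) ∈ y.map some := by rw [← hy]; simp
      simp at this
    obtain ⟨u, v, hp⟩ := hp
    -- from a word without H, terminal steps are bad
    have hterm : bs H ∉ w → ∀ n t, w = u ++ Symbol.nonterminal n :: v → w' = u ++ tm t :: v →
        (t = true → n = Sum.inl H) → (∀ s ∈ w, ¬ isT s) → False := by
      intro hH n t e1 e2 ht hT
      subst e1 e2
      refine hbad (obsv_bad H P out ?_ ⟨tm t, by simp, by simp [isT]⟩ ?_)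
      · simp at hH ⊢
        tauto
      · left
        intro hm
        have hu : (tm true : Sy B R) ∉ u := fun h => hT (tm true) (by simp [h]) (by simp [isT])
        have hv : (tm true : Sy B R) ∉ v := fun h => hT (tm true) (by simp [h]) (by simp [isT])
        have : t = true := by simpa [hu, hv] using hm
        exact hH (by simp [ht this])
    -- the invariant for w
    have hx : ∃ y0 : List Sig, x = y0.map some := by
      cases ho : obsv H P out w' with
      | none => exact ⟨y, by simpa [ho] using hy⟩
      | some o =>
        rw [ho] at hy
        have : (y.map some).take x.length = x := by rw [← hy]; simp
        rw [← List.map_take] at this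
        exact ⟨_, this.symm⟩
    obtain ⟨y0, hx⟩ := hx
    rcases ih y0 hx with ⟨z, rfl, hz, hz0, hd⟩ | ⟨u', r', v', y', rfl, hz, hPr, hd, rfl⟩ | ⟨hc, hw⟩
    · have hH : (bs H : Sy B R) ∉ z.map bs := by simpa using hz
      have hT : ∀ s ∈ (z.map bs : List (Sy B R)), ¬ isT s := by simp [isT]
      rcases hp with ⟨r, e1, e2⟩ | ⟨r, e1, e2⟩ | ⟨n, e1, e2⟩ | ⟨e1, e2⟩
      · obtain ⟨u', b, v', rfl, rfl, hb, rfl⟩ := map_split e1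
        obtain rfl : lhs r = b := by simpa using hb
        have hm := obsv_mark H P out (u := u') (v := v') (r := r)
          (by simp at hz ⊢; tauto)
        rw [← e2] at hm
        by_cases hPw : P w'
        · rw [if_pos hPw] at hm
          refine Or.inr (Or.inl ⟨u', r, v', y0, e2, hz, e2 ▸ hPw, hd, ?_⟩)
          rw [hm, hx] at hy
          have := congrArg (List.filterMap id) hy
          cases ho : out r <;> simpa [ho] using this.symm
        · rw [if_neg hPw] at hm
          exact absurd hm hbad
      · obtain ⟨u', b, v', rfl, rfl, hb, rfl⟩ := map_split e1
        simp at hb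
      · exact (hterm hH n false e1 e2 (by simp) hT).elim
      · exact (hterm hH (Sum.inl H) true e1 e2 (by simp) hT).elim
    · have hz' : H ∉ u' ++ v' := by simp at hz ⊢; tauto
      have hH : (bs H : Sy B R) ∉ u'.map bs ++ mk r' :: v'.map bs := by simpa using hz'
      have hT : ∀ s ∈ (u'.map bs ++ mk r' :: v'.map bs : List (Sy B R)), ¬ isT s := by
        simp [isT, or_imp, forall_and]
      rcases hp with ⟨r, e1, e2⟩ | ⟨r, e1, e2⟩ | ⟨n, e1, e2⟩ | ⟨e1, e2⟩
      · -- second mark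
        exfalso
        have hH' : (bs H : Sy B R) ∉ w' := by
          rw [e1] at hH
          rw [e2]
          simp at hH ⊢
          tauto
        refine hbad (obsv_two H P out hH' ?_ r (by simp [e2]))
        rw [List.append_eq_append_iff] at e1
        rcases e1 with ⟨a, h1, h2⟩ | ⟨c, h1, h2⟩
        · cases a with
          | nil => simp at h2
          | cons s a =>
            simp only [List.cons_append, List.cons.injEq] at h2
            rw [e2, h1, ← h2.1]
            have := minfo_two (u'.map bs) a v r' r
            simpa using this
        · cases c with
          | nil => simp at h2
          | cons s c =>
            simp only [List.cons_append, List.cons.injEq] at h2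
            rw [e2, h2.2]
            exact minfo_two u c _ r r'
      · -- rewriting the mark
        obtain ⟨rfl, rfl, rfl⟩ : r = r' ∧ u = u'.map bs ∧ v = v'.map bs := by
          rw [List.append_eq_append_iff] at e1
          rcases e1 with ⟨a, h1, h2⟩ | ⟨c, h1, h2⟩
          · cases a with
            | nil => simp at h2 h1; exact ⟨h2.1.symm, h1, h2.2.symm⟩
            | cons s a =>
              simp only [List.cons_append, List.cons.injEq] at h2
              have : (mk r : Sy B R) ∈ v'.map bs := by rw [h2.2]; simp
              simp at this
          · cases c with
            | nil => simp at h2 h1; exact ⟨h2.1, h1.symm, h2.2⟩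
            | cons s c =>
              simp only [List.cons_append, List.cons.injEq] at h2
              have : (mk r : Sy B R) ∈ u'.map bs := by rw [h1, h2.1]; simp
              simp at this
        have hd' := Der.step _ u' r v' hd hz hPr
        have e3 : w' = (u' ++ rhs r ++ v').map bs := by simp [e2]
        by_cases hHz : H ∈ u' ++ rhs r ++ v'
        · have hn := obsv_H H P out (w := w') (by rw [e3]; exact bs_mem.2 hHz)
          rw [hn, hx] at hy
          rw [Option.toList_none, List.append_nil] at hy
          rw [List.map_injective_iff.2 (Option.some_injective _) hy] at hd'
          exact Or.inr (Or.inr ⟨⟨_, hHz, hd'⟩, Or.inl (by rw [e3]; exact bs_mem.2 hHz)⟩)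
        · by_cases h0 : u' ++ rhs r ++ v' = []
          · rw [h0] at e3
            exact absurd (e3 ▸ obsv_nil H P out) hbad
          · have hn := obsv_base H P out hHz h0
            rw [← e3] at hn
            rw [hn, hx] at hy
            rw [Option.toList_none, List.append_nil] at hy
            rw [List.map_injective_iff.2 (Option.some_injective _) hy] at hd'
            exact Or.inl ⟨_, e3, hHz, h0, hd'⟩
      · exact (hterm hH n false e1 e2 (by simp) hT).elim
      · exact (hterm hH (Sum.inl H) true e1 e2 (by simp) hT).elim
    · have hfin : (bs H ∈ w' ∨ ∀ s ∈ w', isT s) → Inv H P out lhs rhs S y w' := by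
        intro hw'
        have hn : obsv H P out w' = none := by
          by_cases hH : bs H ∈ w'
          · exact obsv_H H P out hH
          · exact (obsv_allT H P out hH (hw'.resolve_left hH)).resolve_right hbad
        rw [hn, hx] at hy
        rw [Option.toList_none, List.append_nil] at hy
        rw [List.map_injective_iff.2 (Option.some_injective _) hy] at hc
        exact Or.inr (Or.inr ⟨hc, hw'⟩)
      apply hfin
      by_contra hcon
      push Not at hcon
      obtain ⟨h1, s, hs, hs'⟩ := hcon
      have hw : bs H ∈ w := by
        refine hw.resolve_right fun hall => ?_
        rcases hp with ⟨r, e1, e2⟩ | ⟨r, e1, e2⟩ | ⟨n, e1, e2⟩ | ⟨e1, e2⟩ <;>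
        · have := hall _ (by rw [e1]; exact List.mem_append_right _ List.mem_cons_self)
          simp [isT] at this
      rcases hp with ⟨r, e1, e2⟩ | ⟨r, e1, e2⟩ | ⟨n, e1, e2⟩ | ⟨e1, e2⟩
      · subst e1 e2
        have := hl r
        simp at h1 hw
        grind
      · subst e1 e2
        simp at h1 hw
        grind
      · exact hbad (obsv_bad H P out h1 ⟨tm false, by simp [e2], by simp [isT]⟩
          (Or.inr ⟨s, hs, hs'⟩))
      · exact hbad (obsv_bad H P out h1 ⟨tm true, by simp [e2], by simp [isT]⟩
          (Or.inr ⟨s, hs, hs'⟩))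

theorem obs_of_der (hS : S ≠ H) {y : List Sig} {z : List B}
    (h : Der lhs rhs S H P out y z) (hz : z ≠ []) :
    Obs (Pr lhs rhs H) (obsv H P out) [bs S] (z.map bs) (y.map some) := by
  induction h with
  | init =>
    have := Obs.start (pr := Pr lhs rhs H) (A := obsv H P out) (w0 := [bs S])
    have hb := obsv_base H P out (z := [S]) (by simpa using hS.symm) (by simp)
    simp only [List.map_cons, List.map_nil] at hb
    rw [hb] at this
    simpa using this
  | step x u r v hd hH hP ih =>
    have h1 := ih (by simp)
    have h2 := Obs.step _ _ (u.map bs ++ mk r :: v.map bs) h1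
      ⟨u.map bs, v.map bs, Or.inl ⟨r, by simp, rfl⟩⟩
    have h3 := Obs.step _ _ ((u ++ rhs r ++ v).map bs) h2
      ⟨u.map bs, v.map bs, Or.inr (Or.inl ⟨r, rfl, by simp⟩)⟩
    have e1 := obsv_mark H P out (u := u) (v := v) (r := r) (by simp at hH ⊢; tauto)
    rw [if_pos hP] at e1
    have e2 : obsv H P out ((u ++ rhs r ++ v).map bs) = none := by
      by_cases hh : H ∈ u ++ rhs r ++ v
      · exact obsv_H H P out (bs_mem.2 hh)
      · exact obsv_base H P out hh hz
    rw [e1, e2] at h3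
    cases ho : out r <;> simpa [ho] using h3

theorem obs_fin {x : List (Option Sig)} (u v : List B) :
    ∀ (t : List Bool),
    Obs (Pr lhs rhs H) (obsv H P out) [bs S]
      (t.map tm ++ u.map bs ++ bs H :: v.map bs) x →
    ∃ t' : List Bool, Obs (Pr lhs rhs H) (obsv H P out) [bs S]
      (t'.map tm ++ bs H :: v.map bs) x := by
  induction u with
  | nil => intro t h; exact ⟨t, by simpa using h⟩
  | cons a u ih =>
    intro t h
    apply ih (t ++ [false])
    have := Obs.step _ _ (t.map tm ++ tm false :: (u.map bs ++ bs H :: v.map bs)) h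
      ⟨t.map tm, u.map bs ++ bs H :: v.map bs, Or.inr (Or.inr (Or.inl ⟨Sum.inl a, by simp, rfl⟩))⟩
    rw [obsv_H H P out (by simp)] at this
    simpa using this

theorem obs_fin2 {x : List (Option Sig)} (t : List Bool) (v : List B) :
    ∀ (t' : List Bool),
    Obs (Pr lhs rhs H) (obsv H P out) [bs S]
      (t.map tm ++ bs H :: (t'.map tm ++ v.map bs)) x →
    ∃ t' : List Bool, Obs (Pr lhs rhs H) (obsv H P out) [bs S]
      (t.map tm ++ bs H :: t'.map tm) x := by
  induction v with
  | nil => intro t h; exact ⟨t, by simpa using h⟩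
  | cons a v ih =>
    intro t' h
    apply ih (t' ++ [false])
    have := Obs.step _ _ (t.map tm ++ bs H :: (t'.map tm ++ tm false :: v.map bs)) h
      ⟨t.map tm ++ bs H :: t'.map tm, v.map bs,
        Or.inr (Or.inr (Or.inl ⟨Sum.inl a, by simp, by simp⟩))⟩
    rw [obsv_H H P out (by simp)] at this
    simpa using this

theorem goLangBot_gram [Finite B] [Finite R] (hS : S ≠ H) (hl : ∀ r, lhs r ≠ H)
    (y : List Sig) :
    y ∈ goLangBot (gram lhs rhs S H) (obsv H P out) ↔
      ∃ z, H ∈ z ∧ Der lhs rhs S H P out y z := by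
  change y.map some ∈ goLang (gram lhs rhs S H) (obsv H P out) ↔ _
  rw [goLang_eq]
  constructor
  · rintro ⟨t, h⟩
    rcases inv_of_obs H P out lhs rhs S hS hl h y rfl with
      ⟨z, e, hz, hz0, hd⟩ | ⟨u', r', v', y', e, hz, hPr, hd, -⟩ | ⟨hc, -⟩
    · obtain ⟨a, z, rfl⟩ := List.exists_cons_of_ne_nil hz0
      cases t <;> simp at e
    · have : (mk r' : Sy B R) ∈ t.map Symbol.terminal := by rw [e]; simp
      simp at this
    · exact hc
  · rintro ⟨z, hz, hd⟩
    have h := obs_of_der H P out lhs rhs S hS hd (List.ne_nil_of_mem hz)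
    obtain ⟨u, v, rfl⟩ := List.append_of_mem hz
    obtain ⟨t, h⟩ := obs_fin H P out lhs rhs S u v [] (by simpa using h)
    obtain ⟨t', h⟩ := obs_fin2 H P out lhs rhs S t v [] (by simpa using h)
    have := Obs.step _ _ (t.map tm ++ tm true :: t'.map tm) h
      ⟨t.map tm, t'.map tm, Or.inr (Or.inr (Or.inr ⟨by simp, rfl⟩))⟩
    have e : obsv H P out (t.map tm ++ tm true :: t'.map tm) = none := by
      unfold obsv
      rw [if_neg (by simp), if_pos (by simp [isT, or_imp, forall_and]), if_pos (by simp)]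
    rw [e] at this
    refine ⟨t ++ true :: t', ?_⟩
    simpa using this

end Generic
section Concrete

theorem Rec.pi {V K α : Type} [Finite K] {f : K → List V → α} (h : ∀ k, Rec (f k)) :
    Rec fun w k => f k w := by
  choose σ hσ st i o h using h
  refine ⟨∀ k, σ k, inferInstance, fun s a k => st k (s k) a, i, fun s k => o k (s k),
    fun w => ?_⟩
  funext k
  change f k w = _
  rw [h]
  congr 1
  have : ∀ (w : List V) (i : ∀ k, σ k),
      w.foldl (st k) (i k) = w.foldl (fun s a k => st k (s k) a) i k := by
    intro w
    induction w with
    | nil => intro i; rfl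
    | cons a w ih => intro i; exact ih fun k => st k (i k) a
  exact this w i

/-- Base symbols. -/
inductive Bs (K Γ Q : Type)
  | S
  | gen
  | run (q : Q) (b : Bool)
  | del (k : K) (q : Q) (b : Bool)
  | hlt
  | ltr (p : K × Γ)

/-- Rules. -/
inductive Rl (K Γ Q Sig : Type)
  | gen0 (p : K × Γ)
  | start
  | emit (a : Sig)
  | go (b : Bool)
  | act (q : Q) (τ : K → Option Γ) (b : Bool)
  | conf (k : K) (q : Q) (b : Bool)
  | rem (p : K × Γ)

variable {K Γ Q Sig : Type}

instance [Finite K] [Finite Γ] [Finite Q] : Finite (Bs K Γ Q) := by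
  let f : Bs K Γ Q → Bool ⊕ Option (Q × Bool) ⊕ (K × Q × Bool) ⊕ (K × Γ) := fun s =>
    match s with
    | .S => .inl true
    | .gen => .inl false
    | .hlt => .inr (.inl none)
    | .run q b => .inr (.inl (some (q, b)))
    | .del k q b => .inr (.inr (.inl (k, q, b)))
    | .ltr p => .inr (.inr (.inr p))
  refine Finite.of_injective f ?_
  intro a b h
  cases a <;> cases b <;> simp_all [f]

instance [Finite K] [Finite Γ] [Finite Q] [Finite Sig] : Finite (Rl K Γ Q Sig) := by
  let f : Rl K Γ Q Sig → (K × Γ) ⊕ Option Sig ⊕ Bool ⊕ (Q × (K → Option Γ) × Bool) ⊕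
      (K × Q × Bool) ⊕ (K × Γ) := fun s =>
    match s with
    | .gen0 p => .inl p
    | .start => .inr (.inl none)
    | .emit a => .inr (.inl (some a))
    | .go b => .inr (.inr (.inl b))
    | .act q τ b => .inr (.inr (.inr (.inl (q, τ, b))))
    | .conf k q b => .inr (.inr (.inr (.inr (.inl (k, q, b)))))
    | .rem p => .inr (.inr (.inr (.inr (.inr p))))
  refine Finite.of_injective f ?_
  intro a b h
  cases a <;> cases b <;> simp_all [f]

variable [DecidableEq K]

def clhs : Rl K Γ Q Sig → Bs K Γ Q
  | .gen0 _ => .S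
  | .start => .S
  | .emit _ => .gen
  | .go _ => .gen
  | .act q _ b => .run q b
  | .conf k q b => .del k q b
  | .rem p => .ltr p

variable (δ : Q → (K → Option Γ) → Act K Γ Q) (q0 : Q) (enc : Sig → List (K × Γ))

def crhs : Rl K Γ Q Sig → List (Bs K Γ Q)
  | .gen0 p => [.S, .ltr p]
  | .start => [.gen]
  | .emit a => .gen :: (enc a).map .ltr
  | .go b => [.run q0 b]
  | .act q τ b => match δ q τ with
    | .push k a q' => [.run q' (!b), .ltr (k, a)]
    | .pop k q' => match τ k with
      | none => [.run q' b]
      | some _ => [.del k q' b]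
    | .jump q' => [.run q' b]
    | .halt => [.hlt]
  | .conf _ q b => [.run q (!b)]
  | .rem _ => []

def cout : Rl K Γ Q Sig → Option Sig
  | .emit a => some a
  | _ => none

abbrev CS (K Γ Q Sig : Type) := Sy (Bs K Γ Q) (Rl K Γ Q Sig)

def mkf : CS K Γ Q Sig → Option (Rl K Γ Q Sig)
  | .nonterminal (.inr r) => some r
  | _ => none

def cnt : CS K Γ Q Sig → Bool
  | .nonterminal (.inl (.ltr _)) => true
  | .nonterminal (.inr (.rem _)) => true
  | _ => false

def kl (k : K) : CS K Γ Q Sig → Option (Γ × Bool)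
  | .nonterminal (.inl (.ltr p)) => if p.1 = k then some (p.2, false) else none
  | .nonterminal (.inr (.rem p)) => if p.1 = k then some (p.2, true) else none
  | _ => none

def dl : CS K Γ Q Sig → Option (K × Q × Bool)
  | .nonterminal (.inl (.del k q b)) => some (k, q, b)
  | _ => none

def cond (m : Option (Rl K Γ Q Sig)) (e : Prop) (par : Bool) (h : K → Option (Γ × Bool))
    (d : Option (K × Q × Bool)) : Prop :=
  match m with
  | some .start => e
  | some (.go b) => par = b
  | some (.act _ τ _) => ∀ k, (h k).map Prod.fst = τ k
  | some (.conf _ _ b) => par = !b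
  | some (.rem p) => (∃ q, d = some (p.1, q, par)) ∧ (h p.1).map Prod.snd = some true
  | _ => True

def cP (p : List (K × Γ)) (w : List (CS K Γ Q Sig)) : Prop :=
  cond (w.filterMap mkf).head? (w = mk .start :: (p.map Bs.ltr).map bs) (w.countP cnt).bodd
    (fun k => (w.filterMap (kl k)).head?) (w.filterMap dl).head?

theorem rec_cP [Finite K] [Finite Γ] [Finite Q] [Finite Sig] (p : List (K × Γ)) :
    Rec (cP p : List (CS K Γ Q Sig) → Prop) :=
  ((rec_head (mkf : CS K Γ Q Sig → _)).pair ((rec_eq (mk Rl.start :: (p.map Bs.ltr).map bs)).pair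
    ((rec_parity cnt).pair ((Rec.pi fun k => rec_head (kl k)).pair (rec_head dl))))).comp
    fun t => cond t.1 t.2.1 t.2.2.1 t.2.2.2.1 t.2.2.2.2

abbrev LL (v : List (K × Γ)) : List (CS K Γ Q Sig) := (v.map Bs.ltr).map bs

theorem LL_mkf (v : List (K × Γ)) : (LL v : List (CS K Γ Q Sig)).filterMap mkf = [] := by
  simp [LL, mkf, List.filterMap_eq_nil_iff]

theorem LL_dl (v : List (K × Γ)) : (LL v : List (CS K Γ Q Sig)).filterMap dl = [] := by
  simp [LL, dl, List.filterMap_eq_nil_iff]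

theorem LL_cnt (v : List (K × Γ)) : (LL v : List (CS K Γ Q Sig)).countP cnt = v.length := by
  induction v with
  | nil => rfl
  | cons a v ih => simpa [LL, List.countP_cons, cnt] using ih

theorem stksOf_cons (x : K × Γ) (v : List (K × Γ)) (k : K) :
    stksOf (x :: v) k = if x.1 = k then x.2 :: stksOf v k else stksOf v k := by
  by_cases h : x.1 = k <;> simp [stksOf, h]

theorem stksOf_append (u v : List (K × Γ)) (k : K) :
    stksOf (u ++ v) k = stksOf u k ++ stksOf v k := by
  simp [stksOf]

theorem LL_kl (v : List (K × Γ)) (k : K) :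
    (LL v : List (CS K Γ Q Sig)).filterMap (kl k) = (stksOf v k).map fun a => (a, false) := by
  induction v with
  | nil => rfl
  | cons a v ih =>
    rw [stksOf_cons]
    by_cases h : a.1 = k <;> simpa [LL, List.filterMap_cons, kl, h] using ih

theorem stksOf_push (k : K) (a : Γ) (v : List (K × Γ)) :
    stksOf ((k, a) :: v) = Function.update (stksOf v) k (a :: stksOf v k) := by
  funext k'
  rw [stksOf_cons]
  by_cases h : k = k'
  · subst h; simp
  · simp [h, Function.update_of_ne (Ne.symm h)]

theorem stksOf_pop (x : K × Γ) (v1 v2 : List (K × Γ)) (h : stksOf v1 x.1 = []) :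
    Function.update (stksOf (v1 ++ x :: v2)) x.1 (stksOf (v1 ++ x :: v2) x.1).tail =
      stksOf (v1 ++ v2) := by
  funext k'
  by_cases hk : x.1 = k'
  · subst hk
    simp [stksOf_append, stksOf_cons, h]
  · simp [Function.update_of_ne (Ne.symm hk), stksOf_append, stksOf_cons, hk]

theorem update_nil (S : K → List Γ) (k : K) (h : S k = []) :
    Function.update S k (S k).tail = S := by
  funext k'
  by_cases hk : k' = k
  · subst hk; simp [h]
  · simp [hk]

theorem cP_ctl (p : List (K × Γ)) (r : Rl K Γ Q Sig) (hr : ∀ p, r ≠ .rem p)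
    (v : List (K × Γ)) :
    cP p (mk r :: LL v) ↔ cond (some r) (r = .start ∧ v = p) v.length.bodd
      (fun k => (stksOf v k).head?.map fun a => (a, false)) none := by
  have h1 : ((mk r :: LL v : List (CS K Γ Q Sig)).filterMap mkf).head? = some r := by
    simp [mkf]
  have h2 : ((mk r :: LL v : List (CS K Γ Q Sig)).countP cnt) = v.length := by
    rw [List.countP_cons, LL_cnt]
    cases r <;> simp_all [cnt]
  have h3 : ∀ k, ((mk r :: LL v : List (CS K Γ Q Sig)).filterMap (kl k)).head? =
      (stksOf v k).head?.map fun a => (a, false) := by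
    intro k
    have : kl k (mk r : CS K Γ Q Sig) = none := by cases r <;> simp_all [kl]
    rw [List.filterMap_cons_none this, LL_kl]
    simp
  have h4 : ((mk r :: LL v : List (CS K Γ Q Sig)).filterMap dl).head? = none := by
    rw [List.filterMap_cons_none rfl, LL_dl]; rfl
  have h5 : (mk r :: LL v : List (CS K Γ Q Sig)) = mk .start :: LL p ↔ (r = .start ∧ v = p) := by
    have hi : Function.Injective (Bs.ltr : K × Γ → Bs K Γ Q) := fun a b h => by simpa using h
    have hj : Function.Injective (bs : Bs K Γ Q → CS K Γ Q Sig) := fun a b h => by simpa using h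
    simp only [LL, List.cons.injEq, (List.map_injective_iff.2 hj).eq_iff,
      (List.map_injective_iff.2 hi).eq_iff]
    simp
  unfold cP
  rw [h1, h2, h4]
  simp only [h3]
  rw [propext h5]

theorem cP_rem (p : List (K × Γ)) (x : K × Γ) (c : Bs K Γ Q) (hc : ∀ p, c ≠ .ltr p)
    (v1 v2 : List (K × Γ)) :
    cP p (bs c :: LL v1 ++ (mk (.rem x) : CS K Γ Q Sig) :: LL v2) ↔
      (∃ q, c = .del x.1 q (v1 ++ x :: v2).length.bodd) ∧ stksOf v1 x.1 = [] := by
  have h0 : mkf (bs c : CS K Γ Q Sig) = none := rfl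
  have h1 : ((bs c :: LL v1 ++ mk (.rem x) :: LL v2 : List (CS K Γ Q Sig)).filterMap mkf).head? =
      some (.rem x) := by
    rw [List.cons_append, List.filterMap_cons_none h0, List.filterMap_append, LL_mkf]
    simp [mkf]
  have h2 : ((bs c :: LL v1 ++ mk (.rem x) :: LL v2 : List (CS K Γ Q Sig)).countP cnt) =
      (v1 ++ x :: v2).length := by
    rw [List.cons_append, List.countP_cons, List.countP_append, List.countP_cons, LL_cnt, LL_cnt]
    cases c <;> simp_all [cnt]
  have h3 : ((bs c :: LL v1 ++ mk (.rem x) :: LL v2 : List (CS K Γ Q Sig)).filterMap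
      (kl x.1)).head?.map Prod.snd = some true ↔ stksOf v1 x.1 = [] := by
    have : kl x.1 (bs c : CS K Γ Q Sig) = none := by cases c <;> simp_all [kl]
    rw [List.cons_append, List.filterMap_cons_none this, List.filterMap_append, LL_kl]
    cases stksOf v1 x.1 <;> simp [kl]
  have h4 : ∀ q b, ((bs c :: LL v1 ++ mk (.rem x) :: LL v2 : List (CS K Γ Q Sig)).filterMap
      dl).head? = some (x.1, q, b) ↔ c = .del x.1 q b := by
    intro q b
    rw [List.cons_append, List.filterMap_cons, List.filterMap_append, LL_dl,
      List.filterMap_cons_none rfl, LL_dl]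
    cases c <;> simp [dl]
  unfold cP
  rw [h1, h2]
  change (∃ q, _ = _) ∧ _ ↔ _
  rw [h3]
  simp only [h4]

theorem split_ctl {c b : Bs K Γ Q} {v : List (K × Γ)} {u v' : List (Bs K Γ Q)}
    (h : c :: v.map Bs.ltr = u ++ b :: v') :
    (u = [] ∧ b = c ∧ v' = v.map Bs.ltr) ∨ (∃ v1 x v2, u = c :: v1.map Bs.ltr ∧ b = .ltr x ∧
      v' = v2.map Bs.ltr ∧ v = v1 ++ x :: v2) := by
  cases u with
  | nil => simp at h; exact Or.inl ⟨rfl, h.1.symm, h.2.symm⟩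
  | cons d u =>
    simp only [List.cons_append, List.cons.injEq] at h
    obtain ⟨rfl, h⟩ := h
    rw [List.map_eq_append_iff] at h
    obtain ⟨v1, t, rfl, rfl, h⟩ := h
    rw [List.map_eq_cons_iff] at h
    obtain ⟨x, v2, rfl, rfl, rfl⟩ := h
    exact Or.inr ⟨v1, x, v2, rfl, rfl, rfl, rfl⟩

abbrev CDer (p : List (K × Γ)) : List Sig → List (Bs K Γ Q) → Prop :=
  Der clhs (crhs δ q0 enc) .S .hlt (cP p) cout

def CInv (L : List Sig → Prop) (p : List (K × Γ)) (x : List Sig) (w : List (Bs K Γ Q)) : Prop :=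
  ∃ c v, w = c :: v.map Bs.ltr ∧ match c with
    | .S => x = []
    | .gen => v = x.foldl (fun v a => enc a ++ v) p
    | .run q b => v.length.bodd = b ∧ (Halts δ q (stksOf v) → L x)
    | .del k q b => (v.length.bodd = b →
        Halts δ q (Function.update (stksOf v) k (stksOf v k).tail) → L x) ∧
        (v.length.bodd = !b → Halts δ q (stksOf v) → L x)
    | .hlt => L x
    | .ltr _ => False

theorem cinv_of_der (L : List Sig → Prop) (p : List (K × Γ))
    (hL : ∀ x, L x ↔ Halts δ q0 (stksOf (x.foldl (fun v a => enc a ++ v) p)))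
    {x : List Sig} {w : List (Bs K Γ Q)} (h : CDer δ q0 enc p x w) :
    CInv δ enc L p x w := by
  induction h with
  | init => exact ⟨.S, [], rfl, rfl⟩
  | step x u r v' hd hH hP ih =>
    obtain ⟨c, v, e, hi⟩ := ih
    rcases split_ctl e.symm with ⟨rfl, rfl, rfl⟩ | ⟨v1, y, v2, rfl, hb, rfl, rfl⟩
    · have hr : ∀ p, r ≠ .rem p := by
        rintro p rfl
        exact hi
      rw [List.map_nil, List.nil_append, cP_ctl p r hr] at hP
      cases r with
      | gen0 y => exact ⟨.S, y :: v, rfl, by simpa [clhs, cout] using hi⟩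
      | start =>
        have hi : x = [] := hi
        subst hi
        exact ⟨.gen, v, rfl, hP.2⟩
      | emit a =>
        have hi : v = _ := hi
        refine ⟨.gen, enc a ++ v, by simp [crhs], ?_⟩
        simp [cout, hi]
      | go b =>
        have hi : v = _ := hi
        refine ⟨.run q0 b, v, by simp [crhs], hP, ?_⟩
        simp [cout, hL, hi]
      | act q τ b =>
        obtain ⟨hi1, hi2⟩ := hi
        have hτ : τ = fun k => (stksOf v k).head? := by
          funext k
          rw [← hP k]
          generalize e : stksOf v k = l
          cases l <;> simp [e]
        simp only [crhs, cout, Option.toList_none, List.append_nil, List.nil_append]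
        cases ha : δ q τ with
        | push k a q' =>
          refine ⟨.run q' (!b), (k, a) :: v, by simp, by simp [hi1], fun h => hi2 ?_⟩
          rw [stksOf_push] at h
          exact Halts.push _ _ _ _ _ (hτ ▸ ha) h
        | pop k q' =>
          cases hk : τ k with
          | none =>
            refine ⟨.run q' b, v, by simp [hk], hi1, fun h => hi2 ?_⟩
            refine Halts.pop _ _ _ _ (hτ ▸ ha) ?_
            rw [update_nil _ _ (by simpa [hτ] using hk)]
            exact h
          | some a =>
            refine ⟨.del k q' b, v, by simp [hk], fun _ h => hi2 ?_, ?_⟩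
            · exact Halts.pop _ _ _ _ (hτ ▸ ha) h
            · rw [hi1]
              simp
        | jump q' =>
          exact ⟨.run q' b, v, by simp, hi1, fun h => hi2 (Halts.jump _ _ _ (hτ ▸ ha) h)⟩
        | halt =>
          exact ⟨.hlt, v, by simp, hi2 (Halts.halt _ _ (hτ ▸ ha))⟩
      | conf k q b =>
        have hP : v.length.bodd = !b := hP
        refine ⟨.run q (!b), v, by simp [crhs], hP, fun h => ?_⟩
        simpa [cout] using hi.2 hP h
      | rem p => exact (hr p rfl).elim
    · have hr : r = .rem y := by cases r <;> simp_all [clhs]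
      subst hr
      have hc : ∀ p, c ≠ .ltr p := by
        rintro p rfl
        exact hi
      have := cP_rem (Sig := Sig) p y c hc v1 v2
      rw [List.map_cons] at hP
      obtain ⟨⟨q, hq⟩, hk⟩ := this.1 hP
      subst hq
      refine ⟨.del y.1 q (v1 ++ y :: v2).length.bodd, v1 ++ v2, by simp [crhs], ?_, ?_⟩
      · intro hbad
        simp at hbad
      · intro _ h
        have := hi.1 rfl
        rw [stksOf_pop _ _ _ hk] at this
        simpa [cout] using this h

theorem clhs_ne (r : Rl K Γ Q Sig) : clhs r ≠ .hlt := by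
  cases r <;> simp [clhs]

theorem cstep (p : List (K × Γ)) (x : List Sig) (r : Rl K Γ Q Sig) (hr : ∀ p, r ≠ .rem p)
    (v : List (K × Γ)) (h : CDer δ q0 enc p x (clhs r :: v.map Bs.ltr))
    (hc : cond (some r) (r = .start ∧ v = p) v.length.bodd
      (fun k => (stksOf v k).head?.map fun a => (a, false)) none) :
    CDer δ q0 enc p (x ++ (cout r).toList) (crhs δ q0 enc r ++ v.map Bs.ltr) :=
  Der.step x [] r (v.map Bs.ltr) h (by simpa using (clhs_ne r).symm) ((cP_ctl p r hr v).2 hc)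

theorem der_gen0 (p v : List (K × Γ)) : CDer δ q0 enc p [] (.S :: v.map Bs.ltr) := by
  induction v with
  | nil => exact Der.init
  | cons a v ih =>
    have := cstep δ q0 enc p [] (.gen0 a) (by simp) v ih trivial
    simpa [crhs, cout] using this

theorem der_gen (p : List (K × Γ)) (x : List Sig) :
    CDer δ q0 enc p x (.gen :: (x.foldl (fun v a => enc a ++ v) p).map Bs.ltr) := by
  induction x using List.reverseRecOn with
  | nil =>
    have := cstep δ q0 enc p [] .start (by simp) p (der_gen0 δ q0 enc p p) ⟨rfl, rfl⟩
    simpa [crhs, cout] using this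
  | append_singleton x a ih =>
    have := cstep δ q0 enc p x (.emit a) (by simp) _ ih trivial
    simpa [crhs, cout] using this

theorem der_go (p : List (K × Γ)) (x : List Sig) :
    CDer δ q0 enc p x
      (.run q0 (x.foldl (fun v a => enc a ++ v) p).length.bodd ::
        (x.foldl (fun v a => enc a ++ v) p).map Bs.ltr) := by
  have := cstep δ q0 enc p x (.go (x.foldl (fun v a => enc a ++ v) p).length.bodd) (by simp) _
    (der_gen δ q0 enc p x) rfl
  simpa [crhs, cout] using this

theorem first_split (v : List (K × Γ)) (k : K) (h : stksOf v k ≠ []) :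
    ∃ v1 x v2, v = v1 ++ x :: v2 ∧ x.1 = k ∧ stksOf v1 k = [] := by
  induction v with
  | nil => exact (h rfl).elim
  | cons y v ih =>
    by_cases hy : y.1 = k
    · exact ⟨[], y, v, rfl, hy, rfl⟩
    · rw [stksOf_cons, if_neg hy] at h
      obtain ⟨v1, x, v2, rfl, hx, h1⟩ := ih h
      exact ⟨y :: v1, x, v2, rfl, hx, by rw [stksOf_cons, if_neg hy, h1]⟩

theorem der_act (p v : List (K × Γ)) (x : List Sig) (q : Q)
    (h : CDer δ q0 enc p x (.run q v.length.bodd :: v.map Bs.ltr)) :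
    CDer δ q0 enc p x
      (crhs δ q0 enc (.act q (fun k => (stksOf v k).head?) v.length.bodd) ++ v.map Bs.ltr) := by
  have := cstep δ q0 enc p x (.act q (fun k => (stksOf v k).head?) v.length.bodd) (by simp) v
    h (fun k => by
      generalize e : stksOf v k = l
      cases l <;> simp [e])
  simpa [cout] using this

theorem der_of_halts (p : List (K × Γ)) (x : List Sig) (q : Q) (S : K → List Γ)
    (hh : Halts δ q S) : ∀ v : List (K × Γ), stksOf v = S →
      CDer δ q0 enc p x (.run q v.length.bodd :: v.map Bs.ltr) →
      ∃ z, Bs.hlt ∈ z ∧ CDer δ q0 enc p x z := by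
  induction hh with
  | halt q S ha =>
    rintro v rfl h
    have := der_act δ q0 enc p v x q h
    exact ⟨_, by simp [crhs, ha], this⟩
  | jump q S q' ha _ ih =>
    rintro v rfl h
    have := der_act δ q0 enc p v x q h
    refine ih v rfl ?_
    simpa [crhs, ha] using this
  | push q S k a q' ha _ ih =>
    rintro v rfl h
    have := der_act δ q0 enc p v x q h
    refine ih ((k, a) :: v) (stksOf_push k a v) ?_
    simpa [crhs, ha] using this
  | pop q S k q' ha _ ih =>
    rintro v rfl h
    have := der_act δ q0 enc p v x q h
    by_cases hk : stksOf v k = []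
    · refine ih v (update_nil _ _ hk).symm ?_
      simpa [crhs, ha, hk] using this
    · obtain ⟨v1, y, v2, rfl, rfl, h1⟩ := first_split v k hk
      refine ih (v1 ++ v2) (stksOf_pop y v1 v2 h1).symm ?_
      have h2 : CDer δ q0 enc p x
          (.del y.1 q' (v1 ++ y :: v2).length.bodd :: (v1 ++ y :: v2).map Bs.ltr) := by
        obtain ⟨a, ha'⟩ : ∃ a, (stksOf (v1 ++ y :: v2) y.1).head? = some a := by
          cases hs : stksOf (v1 ++ y :: v2) y.1 with
          | nil => exact (hk hs).elim
          | cons a _ => exact ⟨a, rfl⟩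
        simp only [crhs, ha, ha'] at this
        exact this
      have h3 :=
        Der.step x (.del y.1 q' (v1 ++ y :: v2).length.bodd :: v1.map Bs.ltr) (Rl.rem y : Rl K Γ Q Sig)
        (v2.map Bs.ltr) (by rw [List.map_append, List.map_cons] at h2; exact h2) (by simp [clhs])
        ((cP_rem p y _ (by simp) v1 v2).2 ⟨⟨q', rfl⟩, h1⟩)
      have h4 := cstep δ q0 enc p x (.conf y.1 q' (v1 ++ y :: v2).length.bodd) (by simp)
        (v1 ++ v2) (by simpa [clhs, crhs, cout] using h3) (by simp [cond])
      simpa [crhs, cout] using h4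

theorem concrete_main (L : List Sig → Prop) (p : List (K × Γ))
    (hL : ∀ x, L x ↔ Halts δ q0 (stksOf (x.foldl (fun v a => enc a ++ v) p))) (x : List Sig) :
    (∃ z, Bs.hlt ∈ z ∧ CDer δ q0 enc p x z) ↔ L x := by
  constructor
  · rintro ⟨z, hz, hd⟩
    obtain ⟨c, v, rfl, hi⟩ := cinv_of_der δ q0 enc L p hL hd
    have : c = .hlt := by
      simp at hz
      exact hz.symm
    subst this
    exact hi
  · intro h
    exact der_of_halts δ q0 enc p x q0 _ ((hL x).1 h) _ rfl (der_go δ q0 enc p x)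

end Concrete

end UGO

/-- There is a single fixed (universal) context-free grammar `G` such that
every recursively enumerable language `L` over the alphabet `Σ` equals `L_{⊥,f}((G, A))`
for a suitable monadic transducer (observer) `A`. -/
theorem exists_universal_contextFreeGrammar
    (Sig : Type) [Fintype Sig] [Primcodable Sig] :
    ∃ (T : Type) (_ : Finite T) (G : ContextFreeGrammar T) (_ : Finite G.NT),
      ∀ L : Language Sig, (REPred fun x => x ∈ L) →
        ∃ A : List (Symbol T G.NT) → Option (Option Sig),
          ObserverRegular A ∧ goLangBot G A = L := by
  classical
  obtain ⟨Q, hQ, q0, δ, enc, h⟩ := UGO.exists_machine Sig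
  refine ⟨Bool, inferInstance, UGO.gram UGO.clhs (UGO.crhs δ q0 enc) .S .hlt,
    inferInstanceAs (Finite (UGO.Bs _ _ _ ⊕ UGO.Rl _ _ _ _)), fun L hL => ?_⟩
  obtain ⟨p, hp⟩ := h L hL
  refine ⟨UGO.obsv .hlt (UGO.cP p) UGO.cout, (UGO.rec_obsv _ _ (UGO.rec_cP p) _).regular, ?_⟩
  ext y
  rw [UGO.goLangBot_gram _ _ _ _ _ _ (by simp) (by intro r; cases r <;> simp [UGO.clhs])]
  exact UGO.concrete_main δ q0 enc (fun x => x ∈ L) p hp y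
end

section
/- The family of languages generated by simple regular sticker systems is strictly included in the family of regular languages: every language generated by a simple regular sticker system is regular, and there exists a regular language not generated by any simple regular sticker system. -/
/-!  Common definitions for (simple regular) sticker systems and observable sticker systems. -/

/-- A molecule over `V`: an upper strand and a lower strand. -/
abbrev Molecule (V : Type) := List V × List V

/-- A single strand: one of the two strands is empty. -/
def IsSingleStrand {V : Type} (m : Molecule V) : Prop := m.1 = [] ∨ m.2 = []

/-- A complete molecule (an element of `WK_ρ(V)`): both strands have the same length and
all paired positions satisfy the complementarity relation `ρ`. -/
def IsCompleteMolecule {V : Type} (ρ : V → V → Prop) (m : Molecule V) : Prop :=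
  List.Forall₂ ρ m.1 m.2

/-- A well-started molecule (an element of `R_ρ(V) = WK_ρ(V)·S(V)`): a complete
double-stranded part followed by an overhang on the right, which is a single upper or
lower strand. -/
def IsWellStarted {V : Type} (ρ : V → V → Prop) (m : Molecule V) : Prop :=
  ∃ u₁ u₂ v : List V, List.Forall₂ ρ u₁ u₂ ∧
    (m = (u₁ ++ v, u₂) ∨ m = (u₁, u₂ ++ v))

/-- A sticker system: a complementarity relation, a set of axioms and a set of dominoes. -/
structure StickerSystem (V : Type) where
  /-- The complementarity relation `ρ`. -/
  compl : V → V → Prop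
  /-- The set `X` of axioms. -/
  axioms : Set (Molecule V)
  /-- The set `D` of dominoes. -/
  dominoes : Set (Molecule V)

/-- `γ` is a simple regular sticker system: `ρ` is symmetric, the axioms form a finite set
of well-started molecules and the dominoes form a finite set of single strands. -/
def StickerSystem.IsSimpleRegular {V : Type} (γ : StickerSystem V) : Prop :=
  (∀ a b : V, γ.compl a b → γ.compl b a) ∧
  γ.axioms.Finite ∧ (∀ m ∈ γ.axioms, IsWellStarted γ.compl m) ∧
  γ.dominoes.Finite ∧ (∀ m ∈ γ.dominoes, IsSingleStrand m)

/-- One sticking step `u ⇒ w`: some domino `v ∈ D` is attached to the right end of `u`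
(concatenating its strand to the corresponding strand of `u`), the result being again a
well-started molecule (so all newly paired positions satisfy `ρ`). -/
def StickerSystem.Step {V : Type} (γ : StickerSystem V) (u w : Molecule V) : Prop :=
  ∃ v ∈ γ.dominoes, w = (u.1 ++ v.1, u.2 ++ v.2) ∧ IsWellStarted γ.compl w

/-- A complete computation of `γ`: a sequence `w₁ ⇒ w₂ ⇒ ⋯ ⇒ w_k` of sticking steps
starting in an axiom and ending in a complete molecule. -/
def StickerSystem.CompleteComputation {V : Type} (γ : StickerSystem V)
    (ws : List (Molecule V)) : Prop :=
  (∃ a ∈ γ.axioms, ws.head? = some a) ∧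
  List.Chain' γ.Step ws ∧
  ∃ m : Molecule V, ws.getLast? = some m ∧ IsCompleteMolecule γ.compl m

/-- The language generated by a sticker system: the set of upper strands of the final
complete molecules of all complete computations of `γ`. -/
def StickerSystem.language {V : Type} (γ : StickerSystem V) : Language V :=
  { x | ∃ ws : List (Molecule V), γ.CompleteComputation ws ∧
      ∃ m : Molecule V, ws.getLast? = some m ∧ m.1 = x }

/-- The encoding of a molecule as a string over the double-symbol alphabet
`V_d` (modelled inside `Option V × Option V`): position `i` carries the pair of the `i`-th
upper and lower symbols, `none` marking an absent symbol in an overhang. -/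
def encodeMolecule {V : Type} (m : Molecule V) : List (Option V × Option V) :=
  (List.range (max m.1.length m.2.length)).map fun i => (m.1[i]?, m.2[i]?)

/-- The language `L(φ)` of the observable sticker system `φ = (γ, A)`, a language over
`Σ ∪ {⊥}` (= `Option Sig`, `none` being `⊥`): all concatenations `A(w₁)A(w₂)⋯A(w_k)` of
observer outputs along complete computations `(w_i)_{1 ≤ i ≤ k}` of `γ` (the observer reads
molecules encoded over the double-symbol alphabet; output `none` of `A` is the empty
word `λ`). -/
def obsStickerLang {V Sig : Type} (γ : StickerSystem V)
    (A : List (Option V × Option V) → Option (Option Sig)) : Language (Option Sig) :=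
  { x | ∃ ws : List (Molecule V), γ.CompleteComputation ws ∧
      x = (ws.map fun w => (A (encodeMolecule w)).toList).flatten }

/-- The language `L_⊥(φ) = L(φ) ∩ Σ*`: the words of `L(φ)` containing no `⊥`, viewed as a
language over `Σ`. -/
def obsStickerLangBot {V Sig : Type} (γ : StickerSystem V)
    (A : List (Option V × Option V) → Option (Option Sig)) : Language Sig :=
  { x | (x.map some) ∈ obsStickerLang γ A }

theorem wellStarted_of_prefix {V : Type} {ρ : V → V → Prop} {p r q s : List V}
    (h : List.Forall₂ ρ (p ++ r) (q ++ s)) : IsWellStarted ρ (p, q) := by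
  rcases le_total p.length q.length with hl | hl
  · refine ⟨p, q.take p.length, q.drop p.length, ?_, Or.inr (by simp)⟩
    have := List.forall₂_take p.length h
    simpa [List.take_append, Nat.sub_eq_zero_of_le hl] using this
  · refine ⟨p.take q.length, q, p.drop q.length, ?_, Or.inl (by simp)⟩
    have := List.forall₂_take q.length h
    simpa [List.take_append, Nat.sub_eq_zero_of_le hl] using this

/-- words `a d₁ ⋯ dₖ` with `dᵢ ∈ D` -/
def genSet {V : Type} (a : List V) (D : Set (List V)) : Set (List V) :=
  {x | ∃ l : List (List V), (∀ d ∈ l, d ∈ D) ∧ x = a ++ l.flatten}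

/-- suffixes of `a` or of elements of `D` -/
def sufSet {V : Type} (a : List V) (D : Set (List V)) : Set (List V) :=
  {s | s <:+ a ∨ ∃ d ∈ D, s <:+ d}

theorem finite_suffixes {V : Type} (a : List V) : {s | s <:+ a}.Finite := by
  have : {s | s <:+ a} = {s | s ∈ a.tails} := by ext s; simp
  rw [this]; exact List.finite_toSet _

theorem sufSet_finite {V : Type} (a : List V) {D : Set (List V)} (hD : D.Finite) :
    (sufSet a D).Finite := by
  have : sufSet a D = {s | s <:+ a} ∪ ⋃ d ∈ D, {s | s <:+ d} := by
    ext s; simp [sufSet]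
  rw [this]
  exact (finite_suffixes a).union (hD.biUnion fun d _ => finite_suffixes d)

theorem genSet_trans {V : Type} {a x s y : List V} {D : Set (List V)}
    (h : x ++ s ∈ genSet a D) (h' : y ∈ genSet s D) : x ++ y ∈ genSet a D := by
  obtain ⟨l, hl, e⟩ := h
  obtain ⟨l', hl', rfl⟩ := h'
  refine ⟨l ++ l', ?_, ?_⟩
  · intro d hd
    rcases List.mem_append.1 hd with h | h
    · exact hl d h
    · exact hl' d h
  · rw [← List.append_assoc, e]; simp

theorem genSet_split {V : Type} {D : Set (List V)} (l : List (List V)) :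
    ∀ (a x y : List V), (∀ d ∈ l, d ∈ D) → x ++ y = a ++ l.flatten →
    ∃ s ∈ sufSet a D, x ++ s ∈ genSet a D ∧ y ∈ genSet s D := by
  induction l with
  | nil =>
    intro a x y _ e
    refine ⟨y, Or.inl ⟨x, by simpa using e⟩, ⟨[], by simp, by simpa using e⟩, ⟨[], by simp, by simp⟩⟩
  | cons d l ih =>
    intro a x y hl e
    rcases List.append_eq_append_iff.1 e with ⟨s, h1, h2⟩ | ⟨x', h1, h2⟩
    · exact ⟨s, Or.inl ⟨x, h1.symm⟩, ⟨[], by simp, by simp [h1]⟩, ⟨d :: l, hl, h2⟩⟩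
    · obtain ⟨s, hs, ⟨l', hl', e'⟩, h4⟩ := ih d x' y (fun d hd => hl d (by simp [hd]))
        (by simpa using h2.symm)
      have hd : d ∈ D := hl d (by simp)
      refine ⟨s, ?_, ⟨d :: l', ?_, ?_⟩, h4⟩
      · rcases hs with hs | hs
        · exact Or.inr ⟨d, hd, hs⟩
        · exact Or.inr hs
      · intro c hc
        rcases List.mem_cons.1 hc with rfl | hc
        · exact hd
        · exact hl' c hc
      · rw [h1, List.append_assoc, e']; simp

theorem regular_rel {V : Type} (ρ : V → V → Prop) (a : List V) {D : Set (List V)}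
    (hD : D.Finite) :
    Language.IsRegular ({x | ∃ y, List.Forall₂ ρ x y ∧ y ∈ genSet a D} : Language V) := by
  apply Language.IsRegular.of_finite_range_leftQuotient
  refine Set.Finite.subset (((sufSet_finite a hD).finite_subsets).image
    (fun T : Set (List V) => ({z | ∃ s ∈ T, ∃ w, List.Forall₂ ρ z w ∧ w ∈ genSet s D} : Language V))) ?_
  rintro _ ⟨x, rfl⟩
  refine ⟨{s | s ∈ sufSet a D ∧ ∃ y, List.Forall₂ ρ x y ∧ y ++ s ∈ genSet a D}, fun s hs => hs.1, ?_⟩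
  refine Set.ext fun z => ?_
  constructor
  · rintro ⟨s, ⟨hs, y, hy, hys⟩, w, hw, hws⟩
    exact ⟨y ++ w, List.rel_append hy hw, genSet_trans hys hws⟩
  · rintro ⟨y, hy, l, hl, e⟩
    have h1 : List.Forall₂ ρ x (y.take x.length) := by
      simpa using List.forall₂_take x.length hy
    have h2 : List.Forall₂ ρ z (y.drop x.length) := by
      simpa using List.forall₂_drop x.length hy
    obtain ⟨s, hs, h3, h4⟩ := genSet_split l a (y.take x.length) (y.drop x.length) hl (by simpa using e)
    exact ⟨s, ⟨hs, _, h1, h3⟩, _, h2, h4⟩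

theorem regular_gen {V : Type} (a : List V) {D : Set (List V)} (hD : D.Finite) :
    Language.IsRegular (genSet a D : Language V) := by
  have := regular_rel (Eq : V → V → Prop) a hD
  simpa [List.forall₂_eq_eq_eq] using this

theorem regular_empty {V : Type} : Language.IsRegular (∅ : Set (List V)) := by
  apply Language.IsRegular.of_finite_range_leftQuotient
  refine Set.Finite.subset (Set.finite_singleton (∅ : Set (List V))) ?_
  rintro _ ⟨x, rfl⟩
  rfl

theorem regular_biUnion {V ι : Type} {s : Set ι} (hs : s.Finite) (f : ι → Set (List V))
    (hf : ∀ i, Language.IsRegular (f i : Language V)) :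
    Language.IsRegular (⋃ i ∈ s, f i : Set (List V)) := by
  induction s, hs using Set.Finite.induction_on with
  | empty => simpa using regular_empty
  | insert _ _ ih =>
    rw [Set.biUnion_insert]
    exact Language.IsRegular.add (hf _) ih

/-- upper dominoes -/
def upperD {V : Type} (γ : StickerSystem V) : Set (List V) := {u | (u, []) ∈ γ.dominoes}
/-- lower dominoes -/
def lowerD {V : Type} (γ : StickerSystem V) : Set (List V) := {u | ([], u) ∈ γ.dominoes}

theorem upperD_finite {V : Type} {γ : StickerSystem V} (h : γ.IsSimpleRegular) :
    (upperD γ).Finite := by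
  refine (h.2.2.2.1.image Prod.fst).subset ?_
  intro u hu; exact ⟨_, hu, rfl⟩

theorem lowerD_finite {V : Type} {γ : StickerSystem V} (h : γ.IsSimpleRegular) :
    (lowerD γ).Finite := by
  refine (h.2.2.2.1.image Prod.snd).subset ?_
  intro u hu; exact ⟨_, hu, rfl⟩

theorem reach_lower {V : Type} (γ : StickerSystem V) (p : List V) (l : List (List V)) :
    ∀ (q : List V), (∀ d ∈ l, d ∈ lowerD γ) → List.Forall₂ γ.compl p (q ++ l.flatten) →
    Relation.ReflTransGen γ.Step (p, q) (p, q ++ l.flatten) := by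
  induction l with
  | nil => intro q _ _; simpa using Relation.ReflTransGen.refl
  | cons d l ih =>
    intro q hl hf
    have hf' : List.Forall₂ γ.compl p ((q ++ d) ++ l.flatten) := by simpa using hf
    have := ih (q ++ d) (fun d hd => hl d (by simp [hd])) hf'
    have h2 : γ.Step (p, q) (p, q ++ d) :=
      ⟨([], d), hl d (by simp), by simp, wellStarted_of_prefix (r := []) (by simpa using hf)⟩
    have h3 := Relation.ReflTransGen.head h2 this
    simpa using h3

theorem reach_upper {V : Type} (γ : StickerSystem V) (q : List V) (l : List (List V))
    (s : List V) :
    ∀ (p : List V), (∀ d ∈ l, d ∈ upperD γ) → List.Forall₂ γ.compl (p ++ l.flatten) (q ++ s) →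
    Relation.ReflTransGen γ.Step (p, q) (p ++ l.flatten, q) := by
  induction l with
  | nil => intro q _ _; simpa using Relation.ReflTransGen.refl
  | cons d l ih =>
    intro p hl hf
    have hf' : List.Forall₂ γ.compl ((p ++ d) ++ l.flatten) (q ++ s) := by simpa using hf
    have := ih (p ++ d) (fun d hd => hl d (by simp [hd])) hf'
    have h2 : γ.Step (p, q) (p ++ d, q) :=
      ⟨(d, []), hl d (by simp), by simp, wellStarted_of_prefix hf'⟩
    have h3 := Relation.ReflTransGen.head h2 this
    simpa using h3

theorem genSet_snoc {V : Type} {a x d : List V} {D : Set (List V)} (h : x ∈ genSet a D)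
    (hd : d ∈ D) : x ++ d ∈ genSet a D := by
  obtain ⟨l, hl, rfl⟩ := h
  refine ⟨l ++ [d], ?_, by simp⟩
  intro c hc
  rcases List.mem_append.1 hc with h | h
  · exact hl c h
  · rw [List.mem_singleton.1 h]; exact hd

theorem gen_of_reach {V : Type} {γ : StickerSystem V} (h : γ.IsSimpleRegular) {a m : Molecule V}
    (hr : Relation.ReflTransGen γ.Step a m) :
    m.1 ∈ genSet a.1 (upperD γ) ∧ m.2 ∈ genSet a.2 (lowerD γ) := by
  induction hr with
  | refl => exact ⟨⟨[], by simp, by simp⟩, ⟨[], by simp, by simp⟩⟩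
  | tail _ hs ih =>
    obtain ⟨⟨v1, v2⟩, hv, rfl, -⟩ := hs
    rcases h.2.2.2.2 _ hv with h0 | h0
    · simp only at h0; subst h0
      exact ⟨by simpa using ih.1, genSet_snoc ih.2 hv⟩
    · simp only at h0; subst h0
      exact ⟨genSet_snoc ih.1 hv, by simpa using ih.2⟩

theorem mem_language_iff_reach {V : Type} (γ : StickerSystem V) (x : List V) :
    x ∈ γ.language ↔ ∃ a ∈ γ.axioms, ∃ y, Relation.ReflTransGen γ.Step a (x, y) ∧
      List.Forall₂ γ.compl x y := by
  constructor
  · rintro ⟨ws, ⟨⟨a, ha, hh⟩, hc, m, hm, hcm⟩, m', hm', rfl⟩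
    obtain rfl : m = m' := by rw [hm] at hm'; simpa using hm'
    refine ⟨a, ha, m.2, ?_, hcm⟩
    cases ws with
    | nil => simp at hh
    | cons b ws =>
      obtain rfl : b = a := by simpa using hh
      have := List.relationReflTransGen_of_exists_isChain_cons ws hc
        (b := m) (by
          rw [List.getLast?_eq_some_getLast (by simp)] at hm; simpa using hm)
      exact this
  · rintro ⟨a, ha, y, hr, hf⟩
    obtain ⟨l, hl, hl'⟩ := List.exists_isChain_cons_of_relationReflTransGen hr
    have e : (a :: l).getLast? = some (x, y) := by
      rw [List.getLast?_eq_some_getLast (by simp), hl']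
    exact ⟨a :: l, ⟨⟨a, ha, rfl⟩, hl, _, e, hf⟩, _, e, rfl⟩

theorem mem_language_iff {V : Type} {γ : StickerSystem V} (h : γ.IsSimpleRegular) (x : List V) :
    x ∈ γ.language ↔ ∃ a ∈ γ.axioms, x ∈ genSet a.1 (upperD γ) ∧
      ∃ y, List.Forall₂ γ.compl x y ∧ y ∈ genSet a.2 (lowerD γ) := by
  rw [mem_language_iff_reach]
  constructor
  · rintro ⟨a, ha, y, hr, hf⟩
    have := gen_of_reach h hr
    exact ⟨a, ha, this.1, y, hf, this.2⟩
  · rintro ⟨⟨p, q⟩, ha, ⟨l, hl, rfl⟩, y, hf, ⟨l', hl', rfl⟩⟩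
    exact ⟨_, ha, _, (reach_upper γ q l _ p hl hf).trans (reach_lower γ _ l' q hl' hf), hf⟩

theorem language_regular {V : Type} {γ : StickerSystem V} (h : γ.IsSimpleRegular) :
    Language.IsRegular γ.language := by
  have e : γ.language = (⋃ a ∈ γ.axioms, (genSet a.1 (upperD γ) ∩
      {x | ∃ y, List.Forall₂ γ.compl x y ∧ y ∈ genSet a.2 (lowerD γ)}) : Set (List V)) := by
    refine Set.ext fun x => ?_
    refine (mem_language_iff h x).trans ?_
    simp only [Set.mem_iUnion, Set.mem_inter_iff, Set.mem_setOf_eq, exists_prop]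
  rw [e]
  refine regular_biUnion h.2.1 _ fun a => ?_
  exact Language.IsRegular.inf (regular_gen _ (upperD_finite h)) (regular_rel _ _ (lowerD_finite h))

theorem exists_nonempty_of_long {V : Type} {a : List V} {l : List (List V)}
    (h : a.length < (a ++ l.flatten).length) : ∃ d ∈ l, d ≠ [] := by
  by_contra! hc
  have : l.flatten = [] := by simpa using hc
  simp [this] at h

/-- If all `bⁿ` are generated, then `w ∈ L` implies `w bᵐ ∈ L` for some `m ≥ 1`. -/
theorem language_append {V : Type} {γ : StickerSystem V} (h : γ.IsSimpleRegular) (b : V)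
    (hb : ∀ n, List.replicate n b ∈ γ.language) :
    ∃ m ≥ 1, ∀ w ∈ γ.language, w ++ List.replicate m b ∈ γ.language := by
  obtain ⟨N, hN⟩ : ∃ N, ∀ a ∈ γ.axioms, a.1.length < N ∧ a.2.length < N := by
    obtain ⟨M, hM⟩ := (h.2.1.image (fun a => a.1.length + a.2.length)).bddAbove
    refine ⟨M + 1, fun a ha => ?_⟩
    have := hM ⟨a, ha, rfl⟩
    simp only at this
    omega
  obtain ⟨a, ha, ⟨l, hl, e⟩, y, hf, ⟨l', hl', rfl⟩⟩ := (mem_language_iff h _).1 (hb N)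
  have hlen := hf.length_eq
  have := hN a ha
  obtain ⟨u, hu, hu0⟩ : ∃ d ∈ l, d ≠ [] := exists_nonempty_of_long (a := a.1) (by
    rw [← e]; simpa using this.1)
  obtain ⟨v, hv, hv0⟩ : ∃ d ∈ l', d ≠ [] := exists_nonempty_of_long (a := a.2) (by
    rw [← hlen]; simpa using this.2)
  have hu' : u = List.replicate u.length b := by
    rw [List.eq_replicate_iff]
    refine ⟨rfl, fun c hc => ?_⟩
    have : c ∈ List.replicate N b := by
      rw [e]; exact List.mem_append_right _ (List.mem_flatten.2 ⟨u, hu, hc⟩)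
    exact List.eq_of_mem_replicate this
  have hv' : ∀ c ∈ v, γ.compl b c := by
    intro c hc
    have hc' : c ∈ a.2 ++ l'.flatten := List.mem_append_right _ (List.mem_flatten.2 ⟨v, hv, hc⟩)
    obtain ⟨i, hi, rfl⟩ := List.getElem_of_mem hc'
    have := (List.forall₂_iff_get.1 hf).2 i (by rw [hlen]; exact hi) hi
    simpa using this
  have hul : 0 < u.length := List.length_pos_iff.2 hu0
  have hvl : 0 < v.length := List.length_pos_iff.2 hv0
  refine ⟨u.length * v.length, Nat.mul_pos hul hvl, fun w hw => ?_⟩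
  obtain ⟨a', ha', hx, z, hz, hz'⟩ := (mem_language_iff h _).1 hw
  refine (mem_language_iff h _).2 ⟨a', ha', ?_, z ++ (List.replicate u.length v).flatten, ?_, ?_⟩
  · have e1 : List.replicate (u.length * v.length) b = (List.replicate v.length u).flatten := by
      symm
      rw [List.eq_replicate_iff]
      refine ⟨by simp [mul_comm], ?_⟩
      intro c hc
      obtain ⟨d, hd, hc⟩ := List.mem_flatten.1 hc
      rw [List.eq_of_mem_replicate hd, hu'] at hc
      exact List.eq_of_mem_replicate hc
    rw [e1]
    obtain ⟨k, hk, rfl⟩ := hx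
    refine ⟨k ++ List.replicate v.length u, ?_, by simp⟩
    intro c hc
    rcases List.mem_append.1 hc with hc | hc
    · exact hk c hc
    · rw [List.eq_of_mem_replicate hc]; exact hl u hu
  · refine List.rel_append hz ?_
    rw [List.forall₂_iff_get]
    refine ⟨by simp, fun i h1 h2 => ?_⟩
    have := List.getElem_mem h2
    obtain ⟨d, hd, hc⟩ := List.mem_flatten.1 this
    rw [List.eq_of_mem_replicate hd] at hc
    simpa using hv' _ hc
  · obtain ⟨k, hk, rfl⟩ := hz'
    refine ⟨k ++ List.replicate u.length v, ?_, by simp⟩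
    intro c hc
    rcases List.mem_append.1 hc with hc | hc
    · exact hk c hc
    · rw [List.eq_of_mem_replicate hc]; exact hl' v hv

/-- The family of languages generated by simple regular sticker systems
is strictly included in the family of regular languages: every language generated by a
simple regular sticker system is regular, and there is a regular language that is not
generated by any simple regular sticker system. -/
theorem stickerLanguages_strictly_included_in_regular :
    (∀ (V : Type) (_ : Finite V) (γ : StickerSystem V), γ.IsSimpleRegular →
      Language.IsRegular γ.language) ∧
    (∃ (V : Type) (_ : Finite V) (L : Language V), Language.IsRegular L ∧
      ∀ γ : StickerSystem V, γ.IsSimpleRegular → γ.language ≠ L) := by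
  refine ⟨fun V _ γ h => language_regular h, Bool, inferInstance,
    (genSet [] {[true]} ∪ genSet [] {[false]} : Set (List Bool)),
    Language.IsRegular.add (regular_gen _ (Set.finite_singleton _))
      (regular_gen _ (Set.finite_singleton _)), ?_⟩
  have key : ∀ (b : Bool) (x : List Bool), x ∈ genSet [] {[b]} ↔ ∀ c ∈ x, c = b := by
    intro b x
    constructor
    · rintro ⟨l, hl, rfl⟩ c hc
      obtain ⟨d, hd, hc⟩ := List.mem_flatten.1 (by simpa using hc)
      have : d = [b] := hl d hd
      simpa [this] using hc
    · intro hx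
      refine ⟨List.replicate x.length [b], fun d hd => List.eq_of_mem_replicate hd, ?_⟩
      have : x = List.replicate x.length b := List.eq_replicate_iff.2 ⟨rfl, hx⟩
      simpa using this
  intro γ h e
  have mem : ∀ x, x ∈ γ.language ↔ (∀ c ∈ x, c = true) ∨ (∀ c ∈ x, c = false) := by
    intro x
    rw [e, ← key, ← key]
    rfl
  obtain ⟨m, hm, H⟩ := language_append h false
    (fun n => (mem _).2 (Or.inr fun c hc => List.eq_of_mem_replicate hc))
  have h1 := (mem _).1 (H [true] ((mem _).2 (Or.inl (by simp))))
  rcases h1 with h1 | h1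
  · have := h1 false (by simp; omega)
    simp at this
  · have := h1 true (by simp)
    simp at this
end

section
/- For every recursively enumerable language L over an alphabet Σ there exists an observable sticker system φ = (γ, A), with γ a simple regular sticker system, such that L_⊥(φ) = L. That is, observable sticker systems are computationally complete. -/
def encStep (m i : ℕ) : ℕ := 2 ^ i * (2 * m + 1)

def encW {Sig : Type} [Encodable Sig] (x : List Sig) : ℕ :=
  x.foldl (fun m s => encStep m (Encodable.encode s)) 0

theorem encStep_inj {m i m' i' : ℕ} (h : encStep m i = encStep m' i') : m = m' ∧ i = i' := by
  unfold encStep at h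
  induction i generalizing i' with
  | zero =>
    cases i' with
    | zero => simp at h; exact ⟨h, rfl⟩
    | succ j => rw [pow_succ] at h; exfalso; 
                have : 2 * m + 1 = 2 * (2 ^ j * (2 * m' + 1)) := by rw [← mul_assoc, mul_comm 2 (2^j)]; simpa using h
                omega
  | succ k ih =>
    cases i' with
    | zero => rw [pow_succ] at h; exfalso
              have : 2 * m' + 1 = 2 * (2 ^ k * (2 * m + 1)) := by rw [← mul_assoc, mul_comm 2 (2^k)]; simpa using h.symm
              omega
    | succ j =>
      have := @ih j (by rw [pow_succ, pow_succ, mul_right_comm, mul_right_comm (2^j)] at h; exact Nat.eq_of_mul_eq_mul_right (by norm_num) h)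
      exact ⟨this.1, by rw [this.2]⟩

theorem encW_inj {Sig : Type} [Encodable Sig] (x y : List Sig) (h : encW x = encW y) : x = y := by
  induction x using List.reverseRecOn generalizing y with
  | nil =>
    cases y using List.reverseRecOn with
    | nil => rfl
    | append_singleton y b => simp [encW, encStep] at h
  | append_singleton x a ih =>
    cases y using List.reverseRecOn with
    | nil => simp [encW, encStep] at h
    | append_singleton y b =>
      simp only [encW, List.foldl_append, List.foldl_cons, List.foldl_nil] at h
      obtain ⟨h1, h2⟩ := encStep_inj h
      rw [ih y h1, Encodable.encode_injective h2]

theorem encW_computable {Sig : Type} [Primcodable Sig] : Computable (encW : List Sig → ℕ) := by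
  apply Primrec.to_comp
  unfold encW
  have hpow : Primrec fun i : ℕ => 2 ^ i := by
    have : Primrec fun i : ℕ => Nat.rec (motive := fun _ => ℕ) 1 (fun _ r => 2 * r) i :=
      Primrec.nat_rec' Primrec.id (Primrec.const 1)
        ((Primrec.nat_mul.comp (Primrec.const 2) (Primrec.snd.comp Primrec.snd)).to₂)
    refine this.of_eq fun i => ?_
    induction i with
    | zero => rfl
    | succ n ih => simp only [ih, pow_succ]; rw [mul_comm]
  refine Primrec.list_foldl (h := fun _ p => encStep p.1 (Encodable.encode p.2))
    Primrec.id (Primrec.const 0) ?_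
  unfold encStep
  refine Primrec.nat_mul.comp (hpow.comp (Primrec.encode.comp (Primrec.snd.comp Primrec.snd))) ?_
  exact Primrec.nat_add.comp (Primrec.nat_mul.comp (Primrec.const 2) (Primrec.fst.comp Primrec.snd)) (Primrec.const 1)

theorem exists_code_of_re {Sig : Type} [Primcodable Sig] (L : Language Sig)
    (hL : REPred fun x => x ∈ L) :
    ∃ c : Turing.ToPartrec.Code, ∀ x : List Sig, (c.eval [encW x]).Dom ↔ x ∈ L := by
  have h1 : Partrec fun m : ℕ => Nat.rfindOpt fun n : ℕ =>
      ((Encodable.decode n : Option (List Sig)).bind fun x => if encW x = m then some x else none) := by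
    refine Partrec.rfindOpt ?_
    refine Computable.option_bind (Computable.decode.comp Computable.snd) ?_
    have := Computable.cond (α := (ℕ × ℕ) × List Sig) (c := fun p => decide (encW p.2 = p.1.1))
      (Primrec.eq.decide.to_comp.comp (encW_computable.comp Computable.snd) (Computable.fst.comp Computable.fst))
      (Computable.option_some.comp Computable.snd) (Computable.const (none : Option (List Sig)))
    refine this.of_eq fun p => ?_
    by_cases h : encW p.2 = p.1.1 <;> simp [h]
  have h2 := (h1.bind (hL.comp Computable.snd).to₂).bind ((Computable.const 0).partrec.to₂ (β := Unit) (α := ℕ) (σ := ℕ))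
  obtain ⟨c, hc⟩ := Turing.ToPartrec.Code.exists_code (Nat.Partrec'.part_iff₁.2 h2)
  refine ⟨c, fun x => ?_⟩
  have := hc ⟨[encW x], rfl⟩
  dsimp only at this
  rw [this]
  have key : (Nat.rfindOpt fun n : ℕ =>
      ((Encodable.decode n : Option (List Sig)).bind fun y => if encW y = encW x then some y else none)) = Part.some x := by
    have hd : (Nat.rfindOpt fun n : ℕ =>
      ((Encodable.decode n : Option (List Sig)).bind fun y => if encW y = encW x then some y else none)).Dom := by
      rw [Nat.rfindOpt_dom]
      exact ⟨Encodable.encode x, x, by simp⟩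
    refine Part.eq_some_iff.2 ?_
    have hm := Part.get_mem hd
    obtain ⟨n, hn⟩ := Nat.rfindOpt_spec hm
    simp only [Option.mem_def, Option.bind_eq_some_iff] at hn
    obtain ⟨y, -, hy⟩ := hn
    split_ifs at hy with hxy
    rw [encW_inj _ _ hxy] at hy
    simp only [Option.some.injEq] at hy
    rw [← hy] at hm; exact hm
  have e : (List.Vector.head (⟨[encW x], rfl⟩ : List.Vector ℕ 1)) = encW x := rfl
  rw [e, key]
  simp [Part.assert, Part.bind]

open Turing Turing.PartrecToTM2 in
theorem trNat_step (m i : ℕ) :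
    trNat (encStep m i) = List.replicate i Γ'.bit0 ++ Γ'.bit1 :: trNat m := by
  induction i with
  | zero =>
    have : ((2 * m + 1 : ℕ) : Num) = (m : Num).bit1 := by
      rw [← Num.bit1_of_bit1]; push_cast; ring
    simp only [encStep, pow_zero, one_mul, trNat, this, List.replicate_zero, List.nil_append]
    cases (m : Num) <;> rfl
  | succ k ih =>
    have h : encStep m (k+1) = 2 * encStep m k := by unfold encStep; ring
    have : ((2 * encStep m k : ℕ) : Num) = (encStep m k : Num).bit0 := by
      rw [← Num.bit0_of_bit0]; push_cast; ring
    rw [List.replicate_succ, List.cons_append, ← ih, h, trNat, this, trNat]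
    have hne : ((encStep m k : ℕ) : Num) ≠ 0 := by
      intro h0
      have : encStep m k = 0 := by exact_mod_cast h0
      simp [encStep] at this
    cases hq : ((encStep m k : ℕ) : Num) with
    | zero => exact absurd hq hne
    | pos p => rfl

open Turing Turing.PartrecToTM2 in
theorem trNat_encW {Sig : Type} [Encodable Sig] (x : List Sig) :
    (trNat (encW x)).reverse =
      x.flatMap fun s => Γ'.bit1 :: List.replicate (Encodable.encode s) Γ'.bit0 := by
  induction x using List.reverseRecOn with
  | nil => simp [encW]
  | append_singleton x a ih =>
    have : encW (x ++ [a]) = encStep (encW x) (Encodable.encode a) := by simp [encW]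
    rw [this, trNat_step, List.flatMap_append, ← ih]
    simp

/-- The TM1 cell holding the symbol `a` on the main track. -/
def mcell (b : Bool) (a : Turing.PartrecToTM2.Γ') :
    Turing.TM2to1.Γ' Turing.PartrecToTM2.K' (fun _ => Turing.PartrecToTM2.Γ') :=
  (b, Function.update (fun _ => none) Turing.PartrecToTM2.K'.main (some a))

open Turing Turing.PartrecToTM2 in
theorem trInit_eq (l : List PartrecToTM2.Γ') :
    TM2to1.trInit (Γ := fun _ : K' => PartrecToTM2.Γ') K'.main (l ++ [PartrecToTM2.Γ'.cons]) =
      mcell true PartrecToTM2.Γ'.cons :: l.reverse.map (mcell false) := by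
  have : (l ++ [PartrecToTM2.Γ'.cons]).reverse = PartrecToTM2.Γ'.cons :: l.reverse := by simp
  unfold TM2to1.trInit
  rw [this]
  rfl

open Turing Turing.PartrecToTM2 in
theorem exists_tm0 {Sig : Type} [Primcodable Sig] (L : Language Sig)
    (hL : REPred fun x => x ∈ L) :
    ∃ (Γ Λ : Type) (_ : Finite Γ) (_ : Inhabited Γ) (_ : Inhabited Λ) (M : TM0.Machine Γ Λ)
      (S : Set Λ) (a0 : Γ) (blk : Sig → List Γ), S.Finite ∧ TM0.Supports M S ∧
      (∀ s, blk s ≠ []) ∧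
      ∀ x, (TM0.eval M (a0 :: x.flatMap blk)).Dom ↔ x ∈ L := by
  obtain ⟨c, hc⟩ := exists_code_of_re L hL
  let _ : Inhabited PartrecToTM2.Λ' := ⟨trNormal c Cont'.halt⟩
  let _ : Fintype K' := ⟨{K'.main, K'.rev, K'.aux, K'.stack}, by intro x; cases x <;> simp⟩
  have s2 : TM2.Supports tr (codeSupp c Cont'.halt) := tr_supports c Cont'.halt
  have s1 := TM2to1.tr_supports tr s2
  have s0 := TM1to0.tr_supports (TM2to1.tr tr) s1
  refine ⟨TM2to1.Γ' K' (fun _ => PartrecToTM2.Γ'), _, inferInstance, inferInstance, inferInstance,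
    TM1to0.tr (TM2to1.tr tr), _, mcell true Γ'.cons,
    fun s => (Γ'.bit1 :: List.replicate (Encodable.encode s) Γ'.bit0).map (mcell false),
    Finset.finite_toSet _, s0, fun s h => ?_, fun x => ?_⟩
  · exact absurd (congrArg List.length h) (by rw [List.length_map]; simp)
  have h := TM2to1.tr_eval_dom tr K'.main (trList [encW x])
  have e : TM2to1.trInit (Γ := fun _ : K' => PartrecToTM2.Γ') K'.main (trList [encW x]) =
      mcell true PartrecToTM2.Γ'.cons :: x.flatMap fun s =>
        (Γ'.bit1 :: List.replicate (Encodable.encode s) Γ'.bit0).map (mcell false) := by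
    have := trInit_eq (trNat (encW x))
    rw [trNat_encW, List.map_flatMap] at this
    exact this
  have ei : (TM2.init K'.main (trList [encW x]) : PartrecToTM2.Cfg') =
      PartrecToTM2.init c [encW x] := by
    unfold TM2.init PartrecToTM2.init
    congr 1
    funext k
    cases k <;> rfl
  have h3 := tr_eval c [encW x]
  rw [← ei] at h3
  have h4 : (TM2.eval tr K'.main (trList [encW x])).Dom ↔ (c.eval [encW x]).Dom :=
    Iff.of_eq (congrArg Part.Dom h3)
  rw [← hc]
  refine Iff.trans (Iff.of_eq ?_) (h.trans h4)
  have h5 := TM1to0.tr_eval (TM2to1.tr tr) (TM2to1.trInit (Γ := fun _ : K' => PartrecToTM2.Γ') K'.main (trList [encW x]))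
  have h6 := congrArg Part.Dom h5
  refine Eq.trans ?_ h6
  exact congrArg (fun l => (TM0.eval (TM1to0.tr (TM2to1.tr tr)) l).Dom) e.symm
open Turing in
theorem exists_tm0_fin {Sig : Type} [Primcodable Sig] (L : Language Sig)
    (hL : REPred fun x => x ∈ L) :
    ∃ (Γ Λ : Type) (_ : Finite Γ) (_ : Finite Λ) (_ : Inhabited Γ) (_ : Inhabited Λ)
      (M : TM0.Machine Γ Λ) (a0 : Γ) (blk : Sig → List Γ), (∀ s, blk s ≠ []) ∧
      ∀ x, (TM0.eval M (a0 :: x.flatMap blk)).Dom ↔ x ∈ L := by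
  classical
  obtain ⟨Γ, Λ, _, _, _, M, S, a0, blk, hS, ss, hb, hx⟩ := exists_tm0 L hL
  let _ : Inhabited S := ⟨⟨default, ss.1⟩⟩
  let g₁ : PointedMap Λ S := ⟨fun q => if h : q ∈ S then ⟨q, h⟩ else default, by
    rw [dif_pos ss.1]; rfl⟩
  let f₁ : PointedMap Γ Γ := ⟨id, rfl⟩
  refine ⟨Γ, S, inferInstance, hS, inferInstance, inferInstance,
    M.map f₁ f₁ g₁ Subtype.val, a0, blk, hb, fun x => ?_⟩
  rw [← hx]
  have hr := TM0.Machine.map_respects M f₁ f₁ g₁ Subtype.val ss (fun _ => rfl)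
    (fun q hq => by show ((if h : q ∈ S then (⟨q, h⟩ : S) else default) : S).1 = q; rw [dif_pos hq])
  have := StateTransition.tr_eval_dom hr (a₁ := TM0.init (a0 :: x.flatMap blk)) (a₂ := TM0.init (a0 :: x.flatMap blk))
    ⟨ss.1, by rw [TM0.map_init]; congr 1; exact List.map_id _⟩
  exact this

/-- One step of a deterministic queue machine. -/
def qstep {G P : Type} (δ : P → G → Option (P × (G × Option G))) :
    P × List G → Option (P × List G)
  | (_, []) => none
  | (p, a :: Q) => (δ p a).map fun r => (r.1, Q ++ r.2.1 :: r.2.2.toList)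

abbrev QSym (Γ Λ : Type) := Option (Γ × Option Λ)

def qsym {Γ Λ : Type} (a : Γ) : QSym Γ Λ := some (a, none)

/-- Transition function of the queue machine simulating a TM0. -/
def qdelta {Γ Λ : Type} [Inhabited Γ] (M : Λ → Γ → Option (Λ × Turing.TM0.Stmt Γ)) :
    QSym Γ Λ ⊕ (Λ × Γ) → QSym Γ Λ →
      Option ((QSym Γ Λ ⊕ (Λ × Γ)) × (QSym Γ Λ × Option (QSym Γ Λ)))
  | .inl c, some (a, some q) =>
    match M q a with
    | none => none
    | some (q', .write b) => some (.inl (some (b, some q')), (c, none))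
    | some (q', .move .right) => some (.inr (q', a), (c, none))
    | some (q', .move .left) =>
      match c with
      | none => some (.inl (qsym a), (none, some (some (default, some q'))))
      | some (x, _) => some (.inl (qsym a), (some (x, some q'), none))
  | .inl c, some (a, none) => some (.inl (qsym a), (c, none))
  | .inl c, none => some (.inl none, (c, none))
  | .inr (q, a), none => some (.inl none, (qsym a, some (some (default, some q))))
  | .inr (q, a), some (y, _) => some (.inl (some (y, some q)), (qsym a, none))

open StateTransition

section
variable {Γ Λ : Type} [Inhabited Γ] (M : Λ → Γ → Option (Λ × Turing.TM0.Stmt Γ))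

theorem q_copy (l : List Γ) : ∀ (c : QSym Γ Λ) (R L' : List (QSym Γ Λ)) (z : QSym Γ Λ),
    c :: l.map qsym = L' ++ [z] →
    Reaches (qstep (qdelta M)) (.inl c, l.map qsym ++ R) (.inl z, R ++ L') := by
  induction l with
  | nil =>
    intro c R L' z h
    have : L' = [] ∧ c = z := by
      cases L' with
      | nil => simpa using h
      | cons a t => simp at h
    obtain ⟨rfl, rfl⟩ := this
    simp only [List.map_nil, List.nil_append, List.append_nil]
    exact Relation.ReflTransGen.refl
  | cons a l ih =>
    intro c R L' z h
    cases L' with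
    | nil => simp at h
    | cons b t =>
      simp only [List.map_cons, List.cons_append, List.cons.injEq] at h
      obtain ⟨rfl, h⟩ := h
      refine Relation.ReflTransGen.head (b := (.inl (qsym a), l.map qsym ++ (R ++ [c]))) ?_ ?_
      · simp [qstep, qsym, qdelta]
      · have := ih (qsym a) (R ++ [c]) t z h
        unfold Reaches at this
        simpa using this

theorem exists_snoc {α : Type} (c : α) (l : List α) : ∃ L' z, c :: l = L' ++ [z] :=
  ⟨(c :: l).dropLast, (c :: l).getLast (by simp), (List.dropLast_append_getLast (by simp)).symm⟩

theorem q_finish (c : QSym Γ Λ) (r : List Γ) (W : List (QSym Γ Λ)) :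
    Reaches (qstep (qdelta M)) (.inl c, r.map qsym ++ none :: W)
      (.inl none, W ++ c :: r.map qsym) := by
  obtain ⟨L', z, h⟩ := exists_snoc c (r.map qsym)
  refine Relation.ReflTransGen.tail (q_copy M r c (none :: W) L' z h) ?_
  simp [qstep, qdelta, h]

/-- Simulation relation. -/
def QRel (C : Turing.TM0.Cfg Γ Λ) (D : (QSym Γ Λ ⊕ (Λ × Γ)) × List (QSym Γ Λ)) : Prop :=
  ∃ (l r : List Γ) (a : Γ) (q : Λ) (L' : List (QSym Γ Λ)) (z : QSym Γ Λ),
    C = ⟨q, ⟨a, Turing.ListBlank.mk l, Turing.ListBlank.mk r⟩⟩ ∧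
    none :: l.reverse.map qsym = L' ++ [z] ∧
    D = (.inl z, some (a, some q) :: (r.map qsym ++ L'))

theorem q_rel_of (l r : List Γ) (a : Γ) (q : Λ) :
    ∃ D, QRel ⟨q, ⟨a, Turing.ListBlank.mk l, Turing.ListBlank.mk r⟩⟩ D ∧
      Reaches (qstep (qdelta M)) (.inl none, l.reverse.map qsym ++ some (a, some q) :: r.map qsym) D := by
  obtain ⟨L', z, h⟩ := exists_snoc (none : QSym Γ Λ) (l.reverse.map qsym)
  refine ⟨_, ⟨l, r, a, q, L', z, rfl, h, rfl⟩, ?_⟩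
  exact q_copy M l.reverse none _ L' z h

theorem q_respects [Inhabited Λ] :
    Respects (Turing.TM0.step (M : Turing.TM0.Machine Γ Λ)) (qstep (qdelta M)) QRel := by
  rintro _ _ ⟨l, r, a, q, L', z, rfl, h, rfl⟩
  have es : Turing.TM0.step (M : Turing.TM0.Machine Γ Λ)
      ⟨q, ⟨a, Turing.ListBlank.mk l, Turing.ListBlank.mk r⟩⟩ =
      (M q a).map fun p => ⟨p.1, match p.2 with
    | Turing.TM0.Stmt.move d => Turing.Tape.move d ⟨a, Turing.ListBlank.mk l, Turing.ListBlank.mk r⟩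
    | Turing.TM0.Stmt.write a' => Turing.Tape.write a' ⟨a, Turing.ListBlank.mk l, Turing.ListBlank.mk r⟩⟩ := rfl
  rw [es]
  rcases hM : M q a with _ | ⟨q', (_ | _) | b⟩
  · simp [qstep, qdelta, hM]
  · -- left
    simp only [Option.map_some]
    cases l with
    | nil =>
      obtain ⟨D, hD, hR⟩ := q_rel_of M [] (a :: r) default q'
      refine ⟨D, ?_, Relation.TransGen.head' (b := (.inl (qsym a), r.map qsym ++ none :: [some (default, some q')])) ?_ ?_⟩
      · exact hD
      · have : L' = [] ∧ z = none := by
          cases L' with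
          | nil => simpa [eq_comm] using h
          | cons a t => simp at h
        obtain ⟨rfl, rfl⟩ := this
        simp [qstep, qdelta, hM]
      · exact (q_finish M _ _ _).trans hR
    | cons x l =>
      obtain ⟨D, hD, hR⟩ := q_rel_of M l (a :: r) x q'
      refine ⟨D, ?_, Relation.TransGen.head' (b := (.inl (qsym a), r.map qsym ++ none :: (l.reverse.map qsym ++ [some (x, some q')]))) ?_ ?_⟩
      · exact hD
      · have : L' = none :: l.reverse.map qsym ∧ z = qsym x := by
          simp only [List.reverse_cons, List.map_append, List.map_cons, List.map_nil] at h
          rw [← List.cons_append] at h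
          have := List.append_inj' h rfl
          exact ⟨this.1.symm, by simpa using this.2.symm⟩
        obtain ⟨rfl, rfl⟩ := this
        simp [qstep, qdelta, hM, qsym]
      · refine (q_finish M _ _ _).trans ?_
        unfold Reaches at hR
        simpa using hR
  · -- right
    simp only [Option.map_some]
    have s1 : (Sum.inr (q', a), r.map qsym ++ (none :: l.reverse.map qsym)) ∈
        qstep (qdelta M) (.inl z, some (a, some q) :: (r.map qsym ++ L')) := by
      rw [h]
      simp [qstep, qdelta, hM]
    cases r with
    | nil =>
      obtain ⟨D, hD, hR⟩ := q_rel_of M (a :: l) [] default q'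
      refine ⟨D, hD, Relation.TransGen.head' s1 (Relation.ReflTransGen.head ?_ hR)⟩
      simp [qstep, qdelta]
    | cons y r =>
      obtain ⟨D, hD, hR⟩ := q_rel_of M (a :: l) r y q'
      refine ⟨D, hD, Relation.TransGen.head' s1 (Relation.ReflTransGen.head (b :=
        (.inl (some (y, some q')), r.map qsym ++ none :: (l.reverse.map qsym ++ [qsym a]))) ?_ ((q_finish M _ _ _).trans ?_))⟩
      · simp [qstep, qdelta, qsym]
      · unfold Reaches at hR
        simpa using hR
  · -- write
    simp only [Option.map_some]
    obtain ⟨D, hD, hR⟩ := q_rel_of M l r b q'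
    refine ⟨D, hD, Relation.TransGen.head' (b := (.inl (some (b, some q')), r.map qsym ++ (none :: l.reverse.map qsym))) ?_ ((q_finish M _ _ _).trans hR)⟩
    rw [h]
    simp [qstep, qdelta, hM]

end

theorem exists_queue {Sig : Type} [Primcodable Sig] (L : Language Sig)
    (hL : REPred fun x => x ∈ L) :
    ∃ (G P : Type) (_ : Finite G) (_ : Finite P) (δ : P → G → Option (P × (G × Option G)))
      (p0 : P) (g0 g1 : G) (blk : Sig → List G), (∀ s, blk s ≠ []) ∧
      ∀ x, (eval (qstep δ) (p0, g0 :: (x.flatMap blk ++ [g1]))).Dom ↔ x ∈ L := by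
  obtain ⟨Γ, Λ, _, _, _, _, M, a0, blk, hb, hx⟩ := exists_tm0_fin L hL
  refine ⟨QSym Γ Λ, QSym Γ Λ ⊕ (Λ × Γ), inferInstance, inferInstance, qdelta M, .inl none,
    some (a0, some default), qsym default, fun s => (blk s).map qsym, by simpa using hb, fun x => ?_⟩
  rw [← hx]
  refine tr_eval_dom (q_respects M) (a₁ := Turing.TM0.init (a0 :: x.flatMap blk)) ?_
  refine ⟨[], x.flatMap blk ++ [default], a0, default, [], none, ?_, rfl, ?_⟩
  · unfold Turing.TM0.init Turing.Tape.mk₁ Turing.Tape.mk₂ Turing.Tape.mk'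
    congr 2
    simp only [Turing.ListBlank.tail_mk, List.tail_cons]
    exact Quotient.sound (Or.inl ⟨1, by simp⟩)
  · simp [List.map_flatMap]
section Part4

inductive SRun {V Sig : Type} (γ : StickerSystem V)
    (A : List (Option V × Option V) → Option (Option Sig)) : Molecule V → List (Option Sig) → Prop
  | ax (a : Molecule V) : a ∈ γ.axioms → SRun γ A a (A (encodeMolecule a)).toList
  | step (u w : Molecule V) (o : List (Option Sig)) : SRun γ A u o → γ.Step u w →
      SRun γ A w (o ++ (A (encodeMolecule w)).toList)

theorem srun_of_list {V Sig : Type} (γ : StickerSystem V)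
    (A : List (Option V × Option V) → Option (Option Sig)) (ws : List (Molecule V)) :
    (∃ a ∈ γ.axioms, ws.head? = some a) → List.IsChain γ.Step ws →
    ∀ m, ws.getLast? = some m →
      SRun γ A m (ws.map fun w => (A (encodeMolecule w)).toList).flatten := by
  induction ws using List.reverseRecOn with
  | nil => rintro ⟨a, _, h⟩; simp at h
  | append_singleton l w ih =>
    rintro ⟨a, ha, h⟩ hc m hm
    simp only [List.getLast?_append, List.getLast?_singleton, Option.some_or, Option.some.injEq] at hm
    subst hm
    rcases List.eq_nil_or_concat l with rfl | ⟨l', u, rfl⟩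
    · simp at h
      subst h
      simpa using SRun.ax (A := A) w ha
    · rw [List.concat_eq_append] at *
      rw [List.isChain_append] at hc
      have h1 := ih ⟨a, ha, by
        rw [List.head?_append_of_ne_nil _ (by simp)] at h; exact h⟩ hc.1 u (by simp)
      have h2 := SRun.step u w _ h1 (hc.2.2 u (by simp) w (by simp))
      simpa using h2

theorem list_of_srun {V Sig : Type} (γ : StickerSystem V)
    (A : List (Option V × Option V) → Option (Option Sig)) (m : Molecule V) (o : List (Option Sig))
    (h : SRun γ A m o) : ∃ ws : List (Molecule V), (∃ a ∈ γ.axioms, ws.head? = some a) ∧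
      List.IsChain γ.Step ws ∧ ws.getLast? = some m ∧
      o = (ws.map fun w => (A (encodeMolecule w)).toList).flatten := by
  induction h with
  | ax a ha => exact ⟨[a], ⟨a, ha, rfl⟩, by simp, rfl, by simp⟩
  | step u w o _ hs ih =>
    obtain ⟨ws, ⟨a, ha, h1⟩, h2, h3, h4⟩ := ih
    refine ⟨ws ++ [w], ⟨a, ha, ?_⟩, ?_, by simp, by simp [h4]⟩
    · rw [List.head?_append, h1]; rfl
    · rw [List.isChain_append]
      refine ⟨h2, by simp, ?_⟩
      intro x hx y hy
      rw [h3] at hx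
      simp at hx hy
      subst hx hy
      exact hs

theorem mem_obs_iff {V Sig : Type} (γ : StickerSystem V)
    (A : List (Option V × Option V) → Option (Option Sig)) (o : List (Option Sig)) :
    o ∈ obsStickerLang γ A ↔ ∃ m, SRun γ A m o ∧ IsCompleteMolecule γ.compl m := by
  constructor
  · rintro ⟨ws, ⟨h1, h2, m, h3, h4⟩, rfl⟩
    exact ⟨m, srun_of_list γ A ws h1 h2 m h3, h4⟩
  · rintro ⟨m, h, hm⟩
    obtain ⟨ws, h1, h2, h3, h4⟩ := list_of_srun γ A m o h
    exact ⟨ws, ⟨h1, h2, m, h3, hm⟩, h4⟩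

def pairStep {V S T : Type} (f : S → V → S) (g : T → V → T) (st : S × T)
    (x : Option V × Option V) : S × T :=
  (x.1.elim st.1 (f st.1), x.2.elim st.2 (g st.2))

theorem encode_cons_cons {V : Type} (a b : V) (U L : List V) :
    encodeMolecule (a :: U, b :: L) = (some a, some b) :: encodeMolecule (U, L) := by
  simp [encodeMolecule, List.range_succ_eq_map, Nat.succ_max_succ]

theorem encode_cons_nil {V : Type} (a : V) (U : List V) :
    encodeMolecule (a :: U, []) = (some a, none) :: encodeMolecule (U, []) := by
  simp [encodeMolecule, List.range_succ_eq_map]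

theorem encode_nil_cons {V : Type} (b : V) (L : List V) :
    encodeMolecule ([], b :: L) = (none, some b) :: encodeMolecule ([], L) := by
  simp [encodeMolecule, List.range_succ_eq_map]

theorem foldl_encode {V S T : Type} (f : S → V → S) (g : T → V → T) (U L : List V) (s : S) (t : T) :
    (encodeMolecule (U, L)).foldl (pairStep f g) (s, t) = (U.foldl f s, L.foldl g t) := by
  induction U generalizing L s t with
  | nil =>
    induction L generalizing t with
    | nil => rfl
    | cons b L ih => rw [encode_nil_cons, List.foldl_cons]; exact ih _
  | cons a U ih =>
    cases L with
    | nil => rw [encode_cons_nil, List.foldl_cons]; exact ih _ _ _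
    | cons b L => rw [encode_cons_cons, List.foldl_cons]; exact ih _ _ _

theorem observer_regular {W S O : Type} [Finite S] (f : S → W → S) (s : S) (out : S → Option O) :
    ObserverRegular fun w : List W => out (w.foldl f s) := by
  intro o
  have := Fintype.ofFinite S
  exact ⟨S, this, ⟨f, s, {s | out s = o}⟩, rfl⟩

inductive Bl (Sig G : Type)
  | start | letter (s : Sig) | fin | op (b : G × Option G)

inductive US (Sig G : Type)
  | init | letters (o : Option Sig) | run (c : ZMod 3) (b : Option (G × Option G)) | bad

inductive LS (G P : Type)
  | run (c : ZMod 3) (p : P) (b : Option (G × Option G)) | done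

instance {Sig G : Type} [Finite Sig] [Finite G] : Finite (Bl Sig G) := by
  let f : Bl Sig G → Option (Option (Sig ⊕ (G × Option G))) := fun
    | .start => none | .fin => some none | .letter s => some (some (.inl s))
    | .op b => some (some (.inr b))
  refine Finite.of_injective f ?_
  rintro (_ | _ | _ | _) (_ | _ | _ | _) <;> simp [f]

instance {Sig G : Type} [Finite Sig] [Finite G] : Finite (US Sig G) := by
  let f : US Sig G → Option (Option (Option Sig ⊕ (ZMod 3 × Option (G × Option G)))) := fun
    | .init => none | .bad => some none | .letters s => some (some (.inl s))
    | .run c b => some (some (.inr (c, b)))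
  refine Finite.of_injective f ?_
  rintro (_ | _ | _ | _) (_ | _ | _ | _) <;> simp [f]

instance {G P : Type} [Finite P] [Finite G] : Finite (LS G P) := by
  let f : LS G P → Option (ZMod 3 × P × Option (G × Option G)) := fun
    | .done => none | .run c p b => some (c, p, b)
  refine Finite.of_injective f ?_
  rintro (_ | _) (_ | _) <;> simp [f]

variable {Sig G P : Type} 

def content (g0 g1 : G) (blk : Sig → List G) : Bl Sig G → List G
  | .start => [g0] | .letter s => blk s | .fin => [g1] | .op b => b.1 :: b.2.toList

abbrev SV (Sig G : Type) := (G × Option (Bl Sig G)) ⊕ G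

def upAux (b : Bl Sig G) : List G → List (SV Sig G)
  | [] => []
  | x :: xs => .inl (x, some b) :: xs.map fun y => .inl (y, none)

def srho : SV Sig G → SV Sig G → Prop
  | .inl u, .inr g => u.1 = g
  | .inr g, .inl u => u.1 = g
  | _, _ => False

def pay : SV Sig G → G
  | .inl u => u.1
  | .inr g => g

def uStep : US Sig G → Bl Sig G → US Sig G
  | .init, .start => .letters none
  | .letters _, .letter s => .letters (some s)
  | .letters _, .fin => .run 0 none
  | .run c _, .op b => .run (c + 1) (some b)
  | _, _ => .bad

def uStepV (s : US Sig G) : SV Sig G → US Sig G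
  | .inl (_, some b) => uStep s b
  | _ => s

def lStep (δ : P → G → Option (P × (G × Option G))) : LS G P → G → LS G P
  | .run c p _, g => match δ p g with
    | some r => .run (c + 1) r.1 (some r.2)
    | none => .done
  | .done, _ => .done

def lStepV (δ : P → G → Option (P × (G × Option G))) (s : LS G P) : SV Sig G → LS G P
  | .inr g => lStep δ s g
  | _ => s

open Classical in
noncomputable def sout : US Sig G × LS G P → Option (Option Sig)
  | (.letters o, .run _ _ none) => o.map some
  | (.run cu bu, .run cl _ bl) => if (cu = cl ∧ bu = bl) ∨ cl = cu + 1 then none else some none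
  | (.run _ _, .done) => none
  | _ => some none

def mol (ct : Bl Sig G → List G) (bs : List (Bl Sig G)) (gs : List G) : Molecule (SV Sig G) :=
  (bs.flatMap fun b => upAux b (ct b), gs.map .inr)

def theSys (ct : Bl Sig G → List G) : StickerSystem (SV Sig G) where
  compl := srho
  axioms := {mol ct [.start] []}
  dominoes := Set.range (fun b => mol ct [b] []) ∪ Set.range (fun g => mol ct [] [g])

noncomputable def theObs (δ : P → G → Option (P × (G × Option G))) (p0 : P)
    (w : List (Option (SV Sig G) × Option (SV Sig G))) : Option (Option Sig) :=
  sout (w.foldl (pairStep uStepV (lStepV δ)) (US.init, LS.run 0 p0 none))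

theorem foldl_up (b : Bl Sig G) (l : List G) (h : l ≠ []) (s : US Sig G) :
    (upAux b l).foldl uStepV s = uStep s b := by
  cases l with
  | nil => exact absurd rfl h
  | cons x xs =>
    simp only [upAux, List.foldl_cons, uStepV]
    induction xs with
    | nil => rfl
    | cons y ys ih => simpa [uStepV] using ih (by simp)

theorem obs_mol (δ : P → G → Option (P × (G × Option G))) (p0 : P) (ct : Bl Sig G → List G)
    (hct : ∀ b, ct b ≠ []) (bs gs) :
    theObs δ p0 (encodeMolecule (mol ct bs gs)) =
      sout (bs.foldl uStep US.init, gs.foldl (lStep δ) (LS.run 0 p0 none)) := by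
  unfold theObs mol
  rw [foldl_encode]
  congr 2
  · generalize US.init = s
    induction bs generalizing s with
    | nil => rfl
    | cons b bs ih => rw [List.flatMap_cons, List.foldl_append, foldl_up _ _ (hct b), ih]; rfl
  · rw [List.foldl_map]; rfl

theorem pay_up (b : Bl Sig G) (l : List G) : (upAux b l).map pay = l := by
  cases l with
  | nil => rfl
  | cons x xs => simp [upAux, pay, Function.comp_def]

theorem pay_mol (ct : Bl Sig G → List G) (bs gs) :
    (mol ct bs gs).1.map pay = bs.flatMap ct ∧ (mol ct bs gs).2.map pay = gs := by
  constructor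
  · simp [mol, List.map_flatMap, pay_up]
  · simp [mol, pay, Function.comp_def]

theorem pay_eq {U L : List (SV Sig G)} (h : List.Forall₂ srho U L) : U.map pay = L.map pay := by
  induction h with
  | nil => rfl
  | @cons a b _ _ h _ ih =>
    simp only [List.map_cons, ih, List.cons.injEq, and_true]
    rcases a with a | a <;> rcases b with b | b <;> simp_all [srho, pay]

theorem isinl_mol (ct : Bl Sig G → List G) (bs gs) : ∀ v ∈ (mol ct bs gs).1, ∃ u, v = .inl u := by
  intro v hv
  simp only [mol, List.mem_flatMap] at hv
  obtain ⟨b, _, hv⟩ := hv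
  cases h : ct b with
  | nil => simp [h, upAux] at hv
  | cons x xs =>
    simp only [h, upAux, List.mem_cons, List.mem_map] at hv
    rcases hv with rfl | ⟨_, _, rfl⟩ <;> exact ⟨_, rfl⟩

theorem forall2_of (U : List (SV Sig G)) (hU : ∀ v ∈ U, ∃ u, v = .inl u) (gs : List G)
    (h : U.map pay = gs) : List.Forall₂ srho U (gs.map Sum.inr) := by
  subst h
  induction U with
  | nil => exact .nil
  | cons a U ih =>
    obtain ⟨u, rfl⟩ := hU a (by simp)
    exact .cons rfl (ih fun v hv => hU v (by simp [hv]))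

theorem complete_iff (ct : Bl Sig G → List G) (bs gs) :
    IsCompleteMolecule srho (mol ct bs gs) ↔ bs.flatMap ct = gs := by
  constructor
  · intro h
    have := pay_eq h
    rwa [(pay_mol ct bs gs).1, (pay_mol ct bs gs).2] at this
  · intro h
    exact forall2_of _ (isinl_mol ct bs gs) gs ((pay_mol ct bs gs).1.trans h)

theorem ws_of (ct : Bl Sig G → List G) (bs gs Q) (h : bs.flatMap ct = gs ++ Q) :
    IsWellStarted srho (mol ct bs gs) := by
  have h1 := (pay_mol ct bs gs).1
  rw [h] at h1
  obtain ⟨u, v, h2, h3, h4⟩ := List.map_eq_append_iff.1 h1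
  refine ⟨u, gs.map .inr, v, forall2_of u (fun x hx => isinl_mol ct bs gs x (by simp [h2, hx])) gs h3, Or.inl ?_⟩
  rw [← h2]; rfl

theorem ws_dest (ct : Bl Sig G → List G) (bs gs Q g) (h : bs.flatMap ct = gs ++ Q) (hQ : Q ≠ [])
    (hw : IsWellStarted srho (mol ct bs (gs ++ [g]))) : ∃ Q', Q = g :: Q' := by
  obtain ⟨u₁, u₂, v, hf, hm⟩ := hw
  have e := pay_eq hf
  have e1 := (pay_mol ct bs (gs ++ [g])).1
  have e2 := (pay_mol ct bs (gs ++ [g])).2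
  rcases hm with hm | hm <;> rw [hm] at e1 e2
  · simp only [List.map_append] at e1 e2
    rw [e, e2, h, List.append_assoc, List.append_cancel_left_eq] at e1
    exact ⟨v.map pay, e1.symm⟩
  · simp only [List.map_append] at e1 e2
    rw [← e, e1, h, List.append_assoc, List.append_cancel_left_eq] at e2
    cases Q with
    | nil => exact absurd rfl hQ
    | cons a Q => simp at e2; exact ⟨Q, by rw [e2.1]⟩

theorem step_iff (ct : Bl Sig G → List G) (bs gs w) :
    (theSys ct).Step (mol ct bs gs) w ↔ IsWellStarted srho w ∧
      ((∃ b, w = mol ct (bs ++ [b]) gs) ∨ ∃ g, w = mol ct bs (gs ++ [g])) := by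
  have h1 : ∀ b, mol ct (bs ++ [b]) gs =
      ((mol ct bs gs).1 ++ (mol ct [b] []).1, (mol ct bs gs).2 ++ (mol ct [b] []).2) := by
    simp [mol]
  have h2 : ∀ g, mol ct bs (gs ++ [g]) =
      ((mol ct bs gs).1 ++ (mol ct [] [g]).1, (mol ct bs gs).2 ++ (mol ct [] [g]).2) := by
    simp [mol]
  constructor
  · rintro ⟨v, hv, rfl, hw⟩
    refine ⟨hw, ?_⟩
    rcases hv with ⟨b, rfl⟩ | ⟨g, rfl⟩
    · exact .inl ⟨b, (h1 b).symm⟩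
    · exact .inr ⟨g, (h2 g).symm⟩
  · rintro ⟨hw, ⟨b, rfl⟩ | ⟨g, rfl⟩⟩
    · exact ⟨_, .inl ⟨b, rfl⟩, h1 b, hw⟩
    · exact ⟨_, .inr ⟨g, rfl⟩, h2 g, hw⟩

theorem theSys_simple [Finite Sig] [Finite G] (ct : Bl Sig G → List G) :
    (theSys ct).IsSimpleRegular := by
  refine ⟨?_, Set.finite_singleton _, ?_, (Set.finite_range _).union (Set.finite_range _), ?_⟩
  · rintro (a | a) (b | b) <;> simp [theSys, srho]
  · rintro m rfl
    exact ws_of ct _ _ _ (List.nil_append _).symm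
  · rintro m (⟨b, rfl⟩ | ⟨g, rfl⟩)
    · exact .inr rfl
    · exact .inl rfl

end Part4
section Part5
variable {Sig G P : Type} (δ : P → G → Option (P × (G × Option G))) (p0 : P) (g0 g1 : G)
  (blk : Sig → List G)

def qinit (x : List Sig) : P × List G := (p0, g0 :: (x.flatMap blk ++ [g1]))

abbrev uS (bs : List (Bl Sig G)) : US Sig G := bs.foldl uStep US.init
abbrev lS (gs : List G) : LS G P := gs.foldl (lStep δ) (LS.run 0 p0 none)

theorem uS_snoc (bs : List (Bl Sig G)) (b) : uS (bs ++ [b]) = uStep (uS bs) b := by simp [uS]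
theorem lS_snoc (gs : List G) (g) : lS δ p0 (gs ++ [g]) = lStep δ (lS δ p0 gs) g := by simp [lS]

/-- Invariant of bottom-free computations. -/
inductive SInv (x : List Sig) (bs : List (Bl Sig G)) (gs : List G) : Prop
  | input (o : Option Sig) : uS bs = .letters o → gs = [] →
      bs.flatMap (content g0 g1 blk) = g0 :: x.flatMap blk → SInv x bs gs
  | ready (c : ZMod 3) (p : P) (l) (Q : List G) : uS bs = .run c l → lS δ p0 gs = .run c p l →
      bs.flatMap (content g0 g1 blk) = gs ++ Q → 2 ≤ Q.length →
      Reaches (qstep δ) (qinit p0 g0 g1 blk x) (p, Q) → SInv x bs gs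
  | mid (c : ZMod 3) (p : P) (l) (b : G × Option G) (Q : List G) : uS bs = .run c l →
      lS δ p0 gs = .run (c + 1) p (some b) →
      bs.flatMap (content g0 g1 blk) = gs ++ Q → Q ≠ [] →
      Reaches (qstep δ) (qinit p0 g0 g1 blk x) (p, Q ++ b.1 :: b.2.toList) → SInv x bs gs
  | halted (c : ZMod 3) (l) : uS bs = .run c l → lS δ p0 gs = .done →
      (eval (qstep δ) (qinit p0 g0 g1 blk x)).Dom → SInv x bs gs

theorem zmod3_a (c : ZMod 3) : c + 1 ≠ c := by revert c; decide
theorem zmod3_b (c : ZMod 3) : c ≠ c + 1 + 1 := by revert c; decide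
theorem zmod3_c (c : ZMod 3) : c ≠ c + 1 := by revert c; decide
theorem zmod3_d (c : ZMod 3) : c + 1 + 1 ≠ c + 1 := by revert c; decide

theorem dom_of_halt {x : List Sig} {p : P} {g : G} {Q : List G}
    (h : Reaches (qstep δ) (qinit p0 g0 g1 blk x) (p, g :: Q)) (hd : δ p g = none) :
    (eval (qstep δ) (qinit p0 g0 g1 blk x)).Dom := by
  rw [Part.dom_iff_mem]
  exact ⟨_, mem_eval.2 ⟨h, by simp [qstep, hd]⟩⟩

theorem inv_step (x : List Sig) (bs : List (Bl Sig G)) (gs : List G)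
    (h : SInv δ p0 g0 g1 blk x bs gs) (bs' gs')
    (hs : (∃ b, bs' = bs ++ [b] ∧ gs' = gs) ∨ ∃ g, bs' = bs ∧ gs' = gs ++ [g])
    (hw : IsWellStarted srho (mol (content g0 g1 blk) bs' gs'))
    (ho : sout (uS bs', lS δ p0 gs') ≠ some none) :
    ∃ y : List Sig, (sout (uS bs', lS δ p0 gs')).toList = y.map some ∧
      SInv δ p0 g0 g1 blk (x ++ y) bs' gs' := by
  rcases hs with ⟨b, rfl, rfl⟩ | ⟨g, rfl, rfl⟩
  · cases h with
    | input o h1 h2 h3 =>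
      subst h2
      cases b with
      | start => simp [h1, uStep, sout] at ho
      | op b => simp [h1, uStep, sout] at ho
      | letter s =>
        refine ⟨[s], by simp [h1, uStep, sout], .input (some s) (by simp [h1, uStep]) rfl ?_⟩
        simp [h3, content]
      | fin =>
        refine ⟨[], by simp [h1, uStep, sout], .ready 0 p0 none (g0 :: (x.flatMap blk ++ [g1])) (by simp [h1, uStep]) rfl ?_ (by simp) ?_⟩
        · simp [h3, content]
        · rw [List.append_nil]; exact Relation.ReflTransGen.refl
    | ready c p l Q h1 h2 h3 h4 h5 =>
      exfalso
      cases b with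
      | op b => simp [h1, h2, uStep, sout, zmod3_b] at ho
      | _ => simp [h1, h2, uStep, sout] at ho
    | mid c p l b' Q h1 h2 h3 h4 h5 =>
      cases b with
      | op b =>
        have e : b = b' := by
          by_contra hne
          simp [h1, h2, uStep, sout, hne] at ho
        subst e
        refine ⟨[], by simp [h1, h2, uStep, sout], .ready (c + 1) p (some b) (Q ++ b.1 :: b.2.toList) (by simp [h1, uStep]) h2 ?_ ?_ ?_⟩
        · simp [h3, content]
        · have := List.length_pos_iff.2 h4
          simp; omega
        · rwa [List.append_nil]
      | _ => simp [h1, h2, uStep, sout] at ho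
    | halted c l h1 h2 h3 =>
      cases b with
      | op b =>
        refine ⟨[], by simp [h1, h2, uStep, sout], .halted (c + 1) (some b) (by simp [h1, uStep]) h2 (by rwa [List.append_nil])⟩
      | _ => simp [h1, h2, uStep, sout] at ho
  · cases h with
    | input o h1 h2 h3 =>
      subst h2
      cases hd : δ p0 g with
      | none => simp [h1, lStep, hd, sout] at ho
      | some r => simp [h1, lStep, hd, sout] at ho
    | ready c p l Q h1 h2 h3 h4 h5 =>
      obtain ⟨Q', rfl⟩ := ws_dest _ _ _ _ _ h3 (by rintro rfl; simp at h4) hw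
      refine ⟨[], ?_, ?_⟩
      · cases hd : δ p g <;> simp [h1, h2, lStep, hd, sout]
      · rw [List.append_nil]
        cases hd : δ p g with
        | none => exact .halted c l h1 (by simp [h2, lStep, hd]) (dom_of_halt δ p0 g0 g1 blk h5 hd)
        | some r =>
          refine .mid c r.1 l r.2 Q' h1 (by simp [h2, lStep, hd]) (by simp [h3]) (by rintro rfl; simp at h4) ?_
          exact Relation.ReflTransGen.tail h5 (by simp [qstep, hd])
    | mid c p l b Q h1 h2 h3 h4 h5 =>
      obtain ⟨Q', rfl⟩ := ws_dest _ _ _ _ _ h3 h4 hw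
      cases hd : δ p g with
      | none =>
        refine ⟨[], by simp [h1, h2, lStep, hd, sout], ?_⟩
        rw [List.append_nil]
        exact .halted c l h1 (by simp [h2, lStep, hd]) (dom_of_halt δ p0 g0 g1 blk h5 hd)
      | some r => simp [h1, h2, lStep, hd, sout, zmod3_b] at ho
    | halted c l h1 h2 h3 =>
      refine ⟨[], by simp [h1, h2, lStep, sout], ?_⟩
      rw [List.append_nil]
      exact .halted c l h1 (by simp [h2, lStep]) h3

variable (hb : ∀ s, blk s ≠ [])
include hb

theorem content_ne (b : Bl Sig G) : content g0 g1 blk b ≠ [] := by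
  cases b <;> simp [content, hb]

theorem inv_run (m : Molecule (SV Sig G)) (o : List (Option Sig))
    (h : SRun (theSys (content g0 g1 blk)) (theObs δ p0) m o) (hn : none ∉ o) :
    ∃ bs gs x, m = mol (content g0 g1 blk) bs gs ∧ o = x.map some ∧
      SInv δ p0 g0 g1 blk x bs gs := by
  have hc := content_ne g0 g1 blk hb
  induction h with
  | ax a ha =>
    obtain rfl : a = _ := ha
    refine ⟨_, _, [], rfl, ?_, .input none rfl rfl (by simp [content])⟩
    rw [obs_mol δ p0 _ hc]
    rfl
  | step u w o _ hs ih =>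
    rw [List.mem_append, not_or] at hn
    obtain ⟨bs, gs, x, rfl, rfl, hi⟩ := ih hn.1
    rw [step_iff] at hs
    obtain ⟨hw, hs⟩ := hs
    obtain ⟨bs', gs', rfl, hs2⟩ : ∃ bs' gs', w = mol (content g0 g1 blk) bs' gs' ∧
        ((∃ b, bs' = bs ++ [b] ∧ gs' = gs) ∨ ∃ g, bs' = bs ∧ gs' = gs ++ [g]) := by
      rcases hs with ⟨b, h⟩ | ⟨g, h⟩
      · exact ⟨_, _, h, .inl ⟨b, rfl, rfl⟩⟩
      · exact ⟨_, _, h, .inr ⟨g, rfl, rfl⟩⟩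
    rw [obs_mol δ p0 _ hc] at hn ⊢
    obtain ⟨y, h1, h2⟩ := inv_step δ p0 g0 g1 blk x bs gs hi bs' gs' hs2 hw
      (fun h => hn.2 (by rw [h]; simp))
    exact ⟨bs', gs', x ++ y, rfl, by rw [h1, List.map_append], h2⟩

theorem sound (x : List Sig) (h : x ∈ obsStickerLangBot (theSys (content g0 g1 blk)) (theObs δ p0)) :
    (eval (qstep δ) (qinit p0 g0 g1 blk x)).Dom := by
  obtain ⟨m, hr, hm⟩ := (mem_obs_iff _ _ _).1 h
  obtain ⟨bs, gs, y, rfl, hxy, hi⟩ := inv_run δ p0 g0 g1 blk hb m _ hr (by simp)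
  obtain rfl : x = y := List.map_injective_iff.2 (Option.some_injective _) hxy
  have e := (complete_iff _ _ _).1 hm
  cases hi with
  | input o h1 h2 h3 => rw [e, h2] at h3; simp at h3
  | ready c p l Q h1 h2 h3 h4 h5 => rw [e] at h3; simp at h3; simp [h3] at h4
  | mid c p l b Q h1 h2 h3 h4 h5 => rw [e] at h3; simp at h3; exact absurd h3 h4
  | halted c l h1 h2 h3 => exact h3

theorem ext_up {bs gs Q o b} (h : SRun (theSys (content g0 g1 blk)) (theObs δ p0)
      (mol (content g0 g1 blk) bs gs) o) (hQ : bs.flatMap (content g0 g1 blk) = gs ++ Q) :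
    SRun (theSys (content g0 g1 blk)) (theObs δ p0) (mol (content g0 g1 blk) (bs ++ [b]) gs)
      (o ++ (sout (uS (bs ++ [b]), lS δ p0 gs)).toList) := by
  have := SRun.step _ (mol (content g0 g1 blk) (bs ++ [b]) gs) _ h ((step_iff _ _ _ _).2
    ⟨ws_of _ _ _ (Q ++ content g0 g1 blk b) (by simp [hQ]), .inl ⟨b, rfl⟩⟩)
  rwa [obs_mol δ p0 _ (content_ne g0 g1 blk hb)] at this

theorem ext_down {bs gs Q o g} (h : SRun (theSys (content g0 g1 blk)) (theObs δ p0)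
      (mol (content g0 g1 blk) bs gs) o) (hQ : bs.flatMap (content g0 g1 blk) = gs ++ g :: Q) :
    SRun (theSys (content g0 g1 blk)) (theObs δ p0) (mol (content g0 g1 blk) bs (gs ++ [g]))
      (o ++ (sout (uS bs, lS δ p0 (gs ++ [g]))).toList) := by
  have := SRun.step _ (mol (content g0 g1 blk) bs (gs ++ [g])) _ h ((step_iff _ _ _ _).2
    ⟨ws_of _ _ _ Q (by simp [hQ]), .inr ⟨g, rfl⟩⟩)
  rwa [obs_mol δ p0 _ (content_ne g0 g1 blk hb)] at this

theorem run_input (x : List Sig) : ∃ bs o, SRun (theSys (content g0 g1 blk)) (theObs δ p0)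
      (mol (content g0 g1 blk) bs []) (x.map some) ∧ uS bs = .letters o ∧
      bs.flatMap (content g0 g1 blk) = g0 :: x.flatMap blk := by
  induction x using List.reverseRecOn with
  | nil =>
    refine ⟨[.start], none, ?_, rfl, by simp [content]⟩
    have := SRun.ax (γ := theSys (content g0 g1 blk)) (A := theObs δ p0) _ (Set.mem_singleton _)
    rwa [obs_mol δ p0 _ (content_ne g0 g1 blk hb)] at this
  | append_singleton x s ih =>
    obtain ⟨bs, o, h1, h2, h3⟩ := ih
    refine ⟨bs ++ [.letter s], some s, ?_, by simp [h2, uStep], by simp [h3, content]⟩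
    have := ext_up δ p0 g0 g1 blk hb (b := .letter s) h1 (List.nil_append _).symm
    simpa [h2, uStep, sout] using this

theorem run_ready (x : List Sig) (C : P × List G)
    (h : Reaches (qstep δ) (qinit p0 g0 g1 blk x) C) :
    ∃ bs gs c l, SRun (theSys (content g0 g1 blk)) (theObs δ p0)
      (mol (content g0 g1 blk) bs gs) (x.map some) ∧ uS bs = .run c l ∧
      lS δ p0 gs = .run c C.1 l ∧ bs.flatMap (content g0 g1 blk) = gs ++ C.2 ∧ C.2 ≠ [] := by
  induction h with
  | refl =>
    obtain ⟨bs, o, h1, h2, h3⟩ := run_input δ p0 g0 g1 blk hb x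
    refine ⟨bs ++ [.fin], [], 0, none, ?_, by simp [h2, uStep], rfl, by simp [h3, content, qinit], by simp [qinit]⟩
    have := ext_up δ p0 g0 g1 blk hb (b := .fin) h1 (List.nil_append _).symm
    simpa [h2, uStep, sout] using this
  | @tail C D _ hs ih =>
    obtain ⟨bs, gs, c, l, h1, h2, h3, h4, h5⟩ := ih
    obtain ⟨p, Q⟩ := C
    cases Q with
    | nil => simp at h5
    | cons g Q =>
      simp only at h3 h4
      cases hd : δ p g with
      | none => simp [qstep, hd] at hs
      | some r =>
        simp [qstep, hd] at hs
        subst hs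
        have e1 := ext_down δ p0 g0 g1 blk hb h1 h4
        have e2 := ext_up δ p0 g0 g1 blk hb (b := .op r.2) e1 (Q := Q) (by simp [h4])
        refine ⟨bs ++ [.op r.2], gs ++ [g], c + 1, some r.2, ?_, by simp [h2, uStep], by simp [h3, lStep, hd],
          by simp [h4, content], by simp⟩
        · simpa [h2, h3, uStep, lStep, hd, sout] using e2

theorem run_erase (x : List Sig) (Q : List G) : ∀ bs gs c l,
    SRun (theSys (content g0 g1 blk)) (theObs δ p0)
      (mol (content g0 g1 blk) bs gs) (x.map some) → uS bs = .run c l →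
      lS δ p0 gs = .done → bs.flatMap (content g0 g1 blk) = gs ++ Q → 
    ∃ m, SRun (theSys (content g0 g1 blk)) (theObs δ p0) m (x.map some) ∧
      IsCompleteMolecule srho m := by
  induction Q with
  | nil =>
    intro bs gs c l h1 h2 h3 h4
    exact ⟨_, h1, (complete_iff _ _ _).2 (by simpa using h4)⟩
  | cons g Q ih =>
    intro bs gs c l h1 h2 h3 h4
    refine ih bs (gs ++ [g]) c l ?_ h2 (by simp [h3, lStep]) (by simp [h4])
    simpa [h2, h3, lStep, sout] using ext_down δ p0 g0 g1 blk hb h1 h4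

theorem compl_dir (x : List Sig) (h : (eval (qstep δ) (qinit p0 g0 g1 blk x)).Dom) :
    x ∈ obsStickerLangBot (theSys (content g0 g1 blk)) (theObs δ p0) := by
  rw [Part.dom_iff_mem] at h
  obtain ⟨⟨p, Q⟩, h⟩ := h
  obtain ⟨hr, hh⟩ := mem_eval.1 h
  obtain ⟨bs, gs, c, l, h1, h2, h3, h4, h5⟩ := run_ready δ p0 g0 g1 blk hb x _ hr
  refine (mem_obs_iff _ _ _).2 ?_
  cases Q with
  | nil => simp at h5
  | cons g Q =>
    simp only at h3 h4
    have hd : δ p g = none := by simpa [qstep] using hh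
    refine run_erase δ p0 g0 g1 blk hb x Q bs (gs ++ [g]) c l ?_ h2 (by simp [h3, lStep, hd]) (by simp [h4])
    simpa [h2, h3, lStep, hd, sout] using ext_down δ p0 g0 g1 blk hb h1 h4

end Part5

/-- For every recursively enumerable language `L` over an alphabet `Σ`
there is an observable sticker system `φ = (γ, A)`, with `γ` a simple regular sticker
system and `A` a monadic transducer, such that `L_⊥(φ) = L`: observable sticker systems
are computationally complete. -/
theorem observable_sticker_computationally_complete
    {Sig : Type} [Fintype Sig] [Primcodable Sig] (L : Language Sig)
    (hL : REPred fun x => x ∈ L) :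
    ∃ (V : Type) (_ : Finite V) (γ : StickerSystem V)
      (A : List (Option V × Option V) → Option (Option Sig)),
      γ.IsSimpleRegular ∧ ObserverRegular A ∧ obsStickerLangBot γ A = L := by
  obtain ⟨G, P, _, _, δ, p0, g0, g1, blk, hb, hx⟩ := exists_queue L hL
  refine ⟨SV Sig G, inferInstance, theSys (content g0 g1 blk), theObs δ p0,
    theSys_simple _, observer_regular _ _ _, ?_⟩
  ext x
  rw [← hx x]
  exact ⟨sound δ p0 g0 g1 blk hb x, compl_dir δ p0 g0 g1 blk hb x⟩
end
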